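/- arXiv:1912.04569 — 2 statements merged into one kernel-verified Lean document; each statement's English description precedes it below -/
import Mathlib

section
/- Let G be a 4-regular, 4-connected graph and let s and t be two distinct vertices of G. Then G admits an (s,t)-triple, i.e. there is a total order ≤ on V(G) and two edge-disjoint spanning trees I and O of G such that every vertex except t has a neighbor in I that is larger with respect to ≤, and every vertex except s has a neighbor in O that is smaller with respect to ≤. -/
open SimpleGraph

universe u

variable {V : Type u}

/-- `T` is a spanning tree of `G`: a subgraph on the same vertex set which is
connected and acyclic. -/
def IsSpanningTree (G T : SimpleGraph V) : Prop :=
  T ≤ G ∧ T.Connected ∧ T.IsAcyclic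

/-- A 2T-graph: a graph on at least two vertices whose edge set is the disjoint
union of the edge sets of two edge-disjoint spanning trees. -/
def IsTwoT (G : SimpleGraph V) : Prop :=
  2 ≤ Nat.card V ∧
    ∃ I O : SimpleGraph V,
      IsSpanningTree G I ∧ IsSpanningTree G O ∧ I ⊓ O = ⊥ ∧ I ⊔ O = G

/-- An `(s,t)`-triple of `G`: a total (linear) order on the vertices together with two
edge-disjoint spanning trees `I` and `O` of `G` such that every vertex except `t` has a
larger neighbor in `I`, and every vertex except `s` has a smaller neighbor in `O`. -/
def HasSTTriple (G : SimpleGraph V) (s t : V) : Prop :=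
  ∃ (r : LinearOrder V) (I O : SimpleGraph V),
    IsSpanningTree G I ∧ IsSpanningTree G O ∧ I ⊓ O = ⊥ ∧
    (∀ v, v ≠ t → ∃ w, I.Adj v w ∧ r.lt v w) ∧
    (∀ v, v ≠ s → ∃ w, O.Adj v w ∧ r.lt w v)

/-- The degree of a vertex. -/
noncomputable def gdeg (G : SimpleGraph V) (v : V) : ℕ := (G.neighborSet v).ncard

/-- A quartic: a (simple) 2T-graph in which every vertex has degree 3 or 4. -/
def IsQuartic (G : SimpleGraph V) : Prop :=
  IsTwoT G ∧ ∀ v : V, gdeg G v = 3 ∨ gdeg G v = 4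

/-- A transit of a quartic: a vertex of degree 3. -/
def IsTransit (G : SimpleGraph V) (v : V) : Prop := gdeg G v = 3

/-- A quartic is excellent if it admits an `(s,t)`-triple for every pair of distinct
transits `s`, `t`. -/
def Excellent (G : SimpleGraph V) : Prop :=
  ∀ s t : V, IsTransit G s → IsTransit G t → s ≠ t → HasSTTriple G s t

/-- The edge neighborhood of a vertex set `S`: all edges of `G` with exactly one
endpoint in `S`. -/
def edgeNbhd (G : SimpleGraph V) (S : Set V) : Set (Sym2 V) :=
  {e | ∃ u v : V, e = s(u, v) ∧ G.Adj u v ∧ u ∈ S ∧ v ∉ S}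

/-- A set of edges is a matching if no two distinct edges share an endpoint. -/
def IsMatchingSet (M : Set (Sym2 V)) : Prop :=
  ∀ e ∈ M, ∀ f ∈ M, e ≠ f → ∀ v : V, v ∈ e → v ∉ f

/-- A quartic is normal if the edge neighborhood of every proper subquartic is a
matching of size 3 or 4. -/
def NormalQuartic (G : SimpleGraph V) : Prop :=
  ∀ H : G.Subgraph, IsQuartic H.coe → H ≠ ⊤ →
    IsMatchingSet (edgeNbhd G H.verts) ∧
      ((edgeNbhd G H.verts).ncard = 3 ∨ (edgeNbhd G H.verts).ncard = 4)

/-- A generic circuit: a 2T-graph with no proper subgraph which is a 2T-graph. -/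
def IsGenericCircuit (G : SimpleGraph V) : Prop :=
  IsTwoT G ∧ ∀ H : G.Subgraph, IsTwoT H.coe → H = ⊤

/-- Property (*): for every pair of distinct vertices `s, t` there is a spanning
subgraph which is a 2T-graph and admits an `(s,t)`-triple. -/
def PropertyStar (G : SimpleGraph V) : Prop :=
  ∀ s t : V, s ≠ t → ∃ H : SimpleGraph V, H ≤ G ∧ IsTwoT H ∧ HasSTTriple H s t

/-- `G` is obtained by identifying two disjoint copies of the complete graph `K_k`
at a single vertex. -/
def IsTwoCliquesAtVertex (G : SimpleGraph V) (k : ℕ) : Prop :=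
  ∃ (A B : Set V) (x : V), A ∩ B = {x} ∧ A ∪ B = Set.univ ∧ A.ncard = k ∧ B.ncard = k ∧
    ∀ u v : V, G.Adj u v ↔ u ≠ v ∧ ((u ∈ A ∧ v ∈ A) ∨ (u ∈ B ∧ v ∈ B))

/-- The total weight of the pairs in `X ×ˢ Y`. -/
def weightSum {α : Type*} (a : α → α → ℕ) (X Y : Finset α) : ℕ :=
  ∑ x ∈ X, ∑ y ∈ Y, a x y

section WeightSum

variable {α : Type*} {a : α → α → ℕ}

lemma weightSum_comm (hs : ∀ x y, a x y = a y x) (X Y : Finset α) :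
    weightSum a X Y = weightSum a Y X := by
  unfold weightSum
  rw [Finset.sum_comm]
  exact Finset.sum_congr rfl fun y _ => Finset.sum_congr rfl fun x _ => hs x y

lemma weightSum_mono {X X' Y Y' : Finset α} (hX : X ⊆ X') (hY : Y ⊆ Y') :
    weightSum a X Y ≤ weightSum a X' Y' :=
  (Finset.sum_le_sum fun _ _ => Finset.sum_le_sum_of_subset hY).trans
    (Finset.sum_le_sum_of_subset hX)

lemma weightSum_singleton_left (x : α) (Y : Finset α) :
    weightSum a {x} Y = ∑ y ∈ Y, a x y := by
  simp [weightSum]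

lemma weightSum_eq_sum_singleton (X Y : Finset α) :
    weightSum a X Y = ∑ x ∈ X, weightSum a {x} Y := by
  simp [weightSum]

lemma exists_pos_of_weightSum_pos {X Y : Finset α} (h : 0 < weightSum a X Y) :
    ∃ x ∈ X, ∃ y ∈ Y, 0 < a x y := by
  by_contra! hc
  have : weightSum a X Y = 0 :=
    Finset.sum_eq_zero fun x hx => Finset.sum_eq_zero fun y hy => by
      have := hc x hx y hy
      omega
  omega

lemma weightSum_add (b : α → α → ℕ) (X Y : Finset α) :
    weightSum (fun x y => a x y + b x y) X Y = weightSum a X Y + weightSum b X Y := by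
  simp [weightSum, Finset.sum_add_distrib]

lemma one_le_weightSum_singleton {x y : α} {Y : Finset α} (hy : y ∈ Y)
    (h : 0 < a x y) : 1 ≤ weightSum a {x} Y := by
  rw [weightSum_singleton_left]
  exact h.trans_le (Finset.single_le_sum (f := fun y => a x y) (fun _ _ => Nat.zero_le _) hy)

variable [DecidableEq α]

lemma weightSum_union_left {X X' : Finset α} (h : Disjoint X X') (Y : Finset α) :
    weightSum a (X ∪ X') Y = weightSum a X Y + weightSum a X' Y :=
  Finset.sum_union h

lemma weightSum_union_right {Y Y' : Finset α} (h : Disjoint Y Y') (X : Finset α) :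
    weightSum a X (Y ∪ Y') = weightSum a X Y + weightSum a X Y' := by
  simp [weightSum, Finset.sum_union h, Finset.sum_add_distrib]

lemma weightSum_union_self (hs : ∀ x y, a x y = a y x) {X Y : Finset α} (h : Disjoint X Y) :
    weightSum a (X ∪ Y) (X ∪ Y) =
      weightSum a X X + weightSum a Y Y + 2 * weightSum a X Y := by
  rw [weightSum_union_left h, weightSum_union_right h, weightSum_union_right h,
    weightSum_comm hs Y X]
  ring

lemma weightSum_insert_self (hs : ∀ x y, a x y = a y x) (h0 : ∀ x, a x x = 0)
    {X : Finset α} {z : α} (hz : z ∉ X) :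
    weightSum a (insert z X) (insert z X) = weightSum a X X + 2 * weightSum a {z} X := by
  rw [Finset.insert_eq, weightSum_union_self hs (by simpa using hz)]
  simp [weightSum, h0]

lemma weightSum_erase_self (hs : ∀ x y, a x y = a y x) (h0 : ∀ x, a x x = 0)
    {X : Finset α} {z : α} (hz : z ∈ X) :
    weightSum a X X = weightSum a (X.erase z) (X.erase z) + 2 * weightSum a {z} X := by
  have h := weightSum_insert_self hs h0 (Finset.notMem_erase z X)
  rw [Finset.insert_erase hz] at h
  have : weightSum a {z} X = weightSum a {z} (X.erase z) := by
    simp only [weightSum_singleton_left]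
    exact (Finset.sum_erase X (h0 z)).symm
  omega

lemma even_weightSum_self (hs : ∀ x y, a x y = a y x) (h0 : ∀ x, a x x = 0) (X : Finset α) :
    Even (weightSum a X X) := by
  induction X using Finset.induction_on with
  | empty => simp [weightSum]
  | insert z X hz ih =>
    rw [weightSum_insert_self hs h0 hz]
    exact ih.add (even_two_mul _)

lemma weightSum_sdiff_right {X Y : Finset α} (h : Y ⊆ X) (Z : Finset α) :
    weightSum a Z X = weightSum a Z Y + weightSum a Z (X \ Y) := by
  rw [← weightSum_union_right Finset.disjoint_sdiff, Finset.union_sdiff_of_subset h]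

lemma weightSum_sdiff_self (hs : ∀ x y, a x y = a y x) {X Y : Finset α} (h : Y ⊆ X) :
    weightSum a X X =
      weightSum a Y Y + weightSum a (X \ Y) (X \ Y) + 2 * weightSum a Y (X \ Y) := by
  rw [← weightSum_union_self hs Finset.disjoint_sdiff, Finset.union_sdiff_of_subset h]

/-- Supermodularity of the weight spanned by a set. -/
lemma weightSum_union_add_inter (hs : ∀ x y, a x y = a y x) (X Y : Finset α) :
    weightSum a (X ∪ Y) (X ∪ Y) + weightSum a (X ∩ Y) (X ∩ Y) =
      weightSum a X X + weightSum a Y Y + 2 * weightSum a (X \ Y) (Y \ X) := by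
  have e1 : X ∪ Y = (X \ Y) ∪ Y := by ext v; simp
  have d1 : Disjoint (X \ Y) Y := Finset.sdiff_disjoint
  have h1 := weightSum_union_self hs d1
  rw [← e1] at h1
  have h2 := weightSum_sdiff_self hs (Finset.inter_subset_left : X ∩ Y ⊆ X)
  have e2 : X \ (X ∩ Y) = X \ Y := by ext v; simp
  have h3 := weightSum_sdiff_right (a := a) (Finset.inter_subset_right : X ∩ Y ⊆ Y) (X \ Y)
  have e3 : Y \ (X ∩ Y) = Y \ X := by ext v; simp
  rw [e2] at h2
  rw [e3] at h3
  rw [weightSum_comm hs (X ∩ Y) (X \ Y)] at h2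
  omega

lemma two_le_weightSum_singleton {x y y' : α} {Y : Finset α} (hy : y ∈ Y) (hy' : y' ∈ Y)
    (hne : y ≠ y') (h : 0 < a x y) (h' : 0 < a x y') : 2 ≤ weightSum a {x} Y := by
  have hsub : ({y, y'} : Finset α) ⊆ Y := by
    intro v hv
    simp only [Finset.mem_insert, Finset.mem_singleton] at hv
    rcases hv with rfl | rfl <;> assumption
  have h1 := weightSum_mono (a := a) (Finset.Subset.refl {x}) hsub
  rw [weightSum_singleton_left x {y, y'}, Finset.sum_pair hne] at h1
  omega

/-- The weight function of the single unordered pair `{p, q}`. -/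
def pairWeight (p q x y : α) : ℕ :=
  if (x = p ∧ y = q) ∨ (x = q ∧ y = p) then 1 else 0

lemma pairWeight_comm (p q : α) : pairWeight p q = pairWeight q p := by
  unfold pairWeight
  funext x y
  congr 1
  apply propext
  tauto

lemma pairWeight_symm (p q x y : α) : pairWeight p q x y = pairWeight p q y x := by
  unfold pairWeight
  congr 1
  apply propext
  tauto

lemma pairWeight_self {p q : α} (h : p ≠ q) (x : α) : pairWeight p q x x = 0 := by
  unfold pairWeight
  rw [if_neg]
  rintro (⟨rfl, rfl⟩ | ⟨rfl, rfl⟩) <;> exact h rfl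

lemma weightSum_pairWeight_singleton {p q : α} (h : p ≠ q) (x : α) (X : Finset α) :
    weightSum (pairWeight p q) {x} X =
      (if x = p ∧ q ∈ X then 1 else 0) + (if x = q ∧ p ∈ X then 1 else 0) := by
  rw [weightSum_singleton_left]
  have : ∀ y, pairWeight p q x y =
      (if y = q then (if x = p then 1 else 0) else 0) +
        (if y = p then (if x = q then 1 else 0) else 0) := by
    intro y
    unfold pairWeight
    by_cases h1 : x = p <;> by_cases h2 : x = q <;> by_cases h3 : y = p <;>
      by_cases h4 : y = q <;> simp_all
  simp only [this, Finset.sum_add_distrib, Finset.sum_ite_eq']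
  congr 1 <;> (split_ifs <;> simp_all)

lemma weightSum_pairWeight {p q : α} (h : p ≠ q) (X : Finset α) :
    weightSum (pairWeight p q) X X = if p ∈ X ∧ q ∈ X then 2 else 0 := by
  rw [weightSum_eq_sum_singleton]
  simp only [weightSum_pairWeight_singleton h, Finset.sum_add_distrib, ite_and,
    Finset.sum_ite_eq']
  split_ifs <;> rfl

end WeightSum

/-- A ranking `r` of `Z` in which every `v` satisfying `P` chooses a neighbor `u v` above it,
every `v` satisfying `Q` chooses a neighbor `d v` below it, and no edge is chosen twice. -/
structure IsBranching {α : Type*} (a : α → α → ℕ) (Z : Finset α) (P Q : α → Prop)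
    (r : α → ℕ) (u d : α → α) : Prop where
  inj : Set.InjOn r Z
  up_mem : ∀ v ∈ Z, P v → u v ∈ Z
  up_adj : ∀ v ∈ Z, P v → 0 < a v (u v)
  up_lt : ∀ v ∈ Z, P v → r v < r (u v)
  down_mem : ∀ v ∈ Z, Q v → d v ∈ Z
  down_adj : ∀ v ∈ Z, Q v → 0 < a v (d v)
  down_lt : ∀ v ∈ Z, Q v → r (d v) < r v
  distinct : ∀ v ∈ Z, P v → Q (u v) → d (u v) ≠ v

/-- The set `Z` has an ordering with bottom `s`, top `t` and edge choices for all the other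
requirements. -/
def HasSTBranching {α : Type*} (a : α → α → ℕ) (Z : Finset α) (s t : α) : Prop :=
  ∃ r u d, IsBranching a Z (· ≠ t) (· ≠ s) r u d

section Branching

variable {α : Type*} {a : α → α → ℕ} {Z : Finset α} {P Q : α → Prop}
  {r : α → ℕ} {u d : α → α}

lemma IsBranching.bottom_lt {s : α} (h : IsBranching a Z P (· ≠ s) r u d) :
    ∀ v ∈ Z, v ≠ s → r s < r v := by
  intro v hv hvs
  induction hn : r v using Nat.strong_induction_on generalizing v with
  | _ n ih =>
    subst hn
    have h1 := h.down_lt v hv hvs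
    by_cases hd : d v = s
    · rwa [hd] at h1
    · exact (ih _ h1 (d v) (h.down_mem v hv hvs) hd rfl).trans h1

lemma hasSTBranching_singleton (x : α) : HasSTBranching a {x} x x := by
  refine ⟨fun _ => 0, id, id, ?_, ?_, ?_, ?_, ?_, ?_, ?_, ?_⟩ <;> simp

variable [DecidableEq α]

/-- Insert `z` directly above `m`, letting `z` choose the edges to `w` and `l`, and letting the
elements of `A` and `B` choose `z` as their upper and lower neighbor, respectively. -/
lemma IsBranching.insert {a' : α → α → ℕ} (h : IsBranching a' Z P Q r u d) {z l m w : α}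
    (A B : Finset α) (hz : z ∉ Z) (hl : l ∈ Z) (hw : w ∈ Z)
    (hlm : r l ≤ r m) (hmw : r m < r w) (hzl : 0 < a z l) (hzw : 0 < a z w)
    (hA : ∀ v ∈ A, r v ≤ r m ∧ 0 < a v z ∧ v ≠ l)
    (hB : ∀ v ∈ B, r m < r v ∧ 0 < a v z ∧ v ≠ w)
    (hu : ∀ v ∈ Z, P v → v ∉ A → 0 < a v (u v))
    (hd : ∀ v ∈ Z, Q v → v ∉ B → 0 < a v (d v)) :
    IsBranching a (insert z Z) P Q (fun v => if v = z then 2 * r m + 1 else 2 * r v)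
      (fun v => if v = z then w else if v ∈ A then z else u v)
      (fun v => if v = z then l else if v ∈ B then z else d v) := by
  have hne : ∀ v ∈ Z, v ≠ z := fun v hv e => hz (e ▸ hv)
  obtain ⟨g1, g2, g3, g4, g5, g6, g7, g8⟩ := h
  constructor
  · intro x hx y hy hxy
    have := @g1 x
    simp only [Finset.coe_insert, Set.mem_insert_iff, Finset.mem_coe] at hx hy this
    by_cases hxz : x = z <;> by_cases hyz : y = z <;> simp [hxz, hyz] at hxy hx hy ⊢
    · omega
    · omega
    · exact this hx hy hxy
  all_goals
    intro v hv
    simp only [Finset.mem_insert] at hv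
    grind

end Branching

section Laman

variable {α : Type*} {a : α → α → ℕ}

lemma card_filter_pos_eq_weightSum {z : α} {Z : Finset α} (h1 : ∀ y ∈ Z, a z y ≤ 1) :
    (Z.filter fun y => 0 < a z y).card = weightSum a {z} Z := by
  rw [weightSum_singleton_left, Finset.card_filter]
  refine Finset.sum_congr rfl fun y hy => ?_
  have := h1 y hy
  split_ifs <;> omega

variable [DecidableEq α]

/-- A vertex with three neighbors in a Laman graph can be replaced by an edge joining two
of its neighbors. -/
lemma exists_admissible_pair (hs : ∀ x y, a x y = a y x) (h0 : ∀ x, a x x = 0)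
    {Z : Finset α} {z b₁ b₂ b₃ : α} (hz : z ∉ Z)
    (hsp : ∀ X ⊆ insert z Z, 2 ≤ X.card → weightSum a X X + 6 ≤ 4 * X.card)
    (h₁ : b₁ ∈ Z) (h₂ : b₂ ∈ Z) (h₃ : b₃ ∈ Z) (h₁₂ : b₁ ≠ b₂) (h₁₃ : b₁ ≠ b₃) (h₂₃ : b₂ ≠ b₃)
    (ha₁ : 0 < a z b₁) (ha₂ : 0 < a z b₂) (ha₃ : 0 < a z b₃) :
    ∃ x ∈ Z, ∃ y ∈ Z, ∃ c ∈ Z, x ≠ y ∧ c ≠ x ∧ c ≠ y ∧ 0 < a z x ∧ 0 < a z y ∧ 0 < a z c ∧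
      ∀ X ⊆ Z, x ∈ X → y ∈ X → weightSum a X X + 8 ≤ 4 * X.card := by
  have hall : ∀ X ⊆ Z, b₁ ∈ X → b₂ ∈ X → b₃ ∈ X → weightSum a X X + 8 ≤ 4 * X.card := by
    intro X hX m₁ m₂ m₃
    have hzX : z ∉ X := fun h => hz (hX h)
    have e1 := weightSum_insert_self hs h0 hzX
    have hsub : ({b₁, b₂, b₃} : Finset α) ⊆ X := by
      intro v hv
      simp only [Finset.mem_insert, Finset.mem_singleton] at hv
      rcases hv with rfl | rfl | rfl <;> assumption
    have e2 := weightSum_mono (a := a) (Finset.Subset.refl {z}) hsub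
    rw [weightSum_singleton_left z {b₁, b₂, b₃}, Finset.sum_insert (by simp [h₁₂, h₁₃]),
      Finset.sum_pair h₂₃] at e2
    have e3 := Finset.card_insert_of_notMem hzX
    have e4 := hsp _ (Finset.insert_subset_insert z hX)
      (by have := Finset.card_pos.2 ⟨_, m₁⟩; omega)
    omega
  by_contra! hc
  have key : ∀ x ∈ Z, ∀ y ∈ Z, ∀ c ∈ Z, x ≠ y → c ≠ x → c ≠ y → 0 < a z x → 0 < a z y →
      0 < a z c → ∃ X ⊆ Z, x ∈ X ∧ y ∈ X ∧ weightSum a X X + 6 = 4 * X.card := by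
    intro x hx y hy c hc' n1 n2 n3 p1 p2 p3
    obtain ⟨X, hX, m1, m2, hlt⟩ := hc x hx y hy c hc' n1 n2 n3 p1 p2 p3
    refine ⟨X, hX, m1, m2, ?_⟩
    have := hsp X (hX.trans (Finset.subset_insert _ _))
      (Finset.one_lt_card.2 ⟨x, m1, y, m2, n1⟩)
    obtain ⟨k, hk⟩ := even_weightSum_self hs h0 X
    omega
  have hinter : ∀ X ⊆ Z, ∀ Y ⊆ Z, ∀ b, weightSum a X X + 6 = 4 * X.card →
      weightSum a Y Y + 6 = 4 * Y.card → b ∈ X → b ∈ Y →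
      b₁ ∈ X ∪ Y → b₂ ∈ X ∪ Y → b₃ ∈ X ∪ Y → X ∩ Y = {b} := by
    intro X hX Y hY b tX tY bX bY m1 m2 m3
    by_contra hne
    have hcard : 2 ≤ (X ∩ Y).card := by
      by_contra hlt
      refine hne (Finset.eq_singleton_iff_unique_mem.2 ⟨Finset.mem_inter.2 ⟨bX, bY⟩, ?_⟩)
      intro x hx
      exact Finset.card_le_one.1 (by omega) x hx b (Finset.mem_inter.2 ⟨bX, bY⟩)
    have e1 := weightSum_union_add_inter hs X Y
    have e2 := hsp (X ∩ Y)
      ((Finset.inter_subset_left.trans hX).trans (Finset.subset_insert _ _)) hcard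
    have e3 := hall _ (Finset.union_subset hX hY) m1 m2 m3
    have e4 := Finset.card_union_add_card_inter X Y
    omega
  obtain ⟨X, hX, X1, X2, tX⟩ := key b₁ h₁ b₂ h₂ b₃ h₃ h₁₂ h₁₃.symm h₂₃.symm ha₁ ha₂ ha₃
  obtain ⟨Y, hY, Y1, Y3, tY⟩ := key b₁ h₁ b₃ h₃ b₂ h₂ h₁₃ h₁₂.symm h₂₃ ha₁ ha₃ ha₂
  obtain ⟨W, hW, W2, W3, tW⟩ := key b₂ h₂ b₃ h₃ b₁ h₁ h₂₃ h₁₂ h₁₃ ha₂ ha₃ ha₁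
  have iXY := hinter X hX Y hY b₁ tX tY X1 Y1 (by simp [*]) (by simp [*]) (by simp [*])
  have iXW := hinter X hX W hW b₂ tX tW X2 W2 (by simp [*]) (by simp [*]) (by simp [*])
  have iYW := hinter Y hY W hW b₃ tY tW Y3 W3 (by simp [*]) (by simp [*]) (by simp [*])
  have iU : (X ∪ Y) ∩ W = {b₂, b₃} := by
    rw [Finset.union_inter_distrib_right, iXW, iYW]
    rfl
  have e1 := weightSum_union_add_inter hs X Y
  have e2 := weightSum_union_add_inter hs (X ∪ Y) W
  have c1 := Finset.card_union_add_card_inter X Y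
  have c2 := Finset.card_union_add_card_inter (X ∪ Y) W
  have e3 : a b₂ b₃ ≤ weightSum a (X \ Y) (Y \ X) := by
    have hb2 : b₂ ∉ Y := fun h => h₁₂ (by
      have : b₂ ∈ X ∩ Y := Finset.mem_inter.2 ⟨X2, h⟩
      rw [iXY] at this
      exact (Finset.mem_singleton.1 this).symm)
    have hb3 : b₃ ∉ X := fun h => h₁₃ (by
      have : b₃ ∈ X ∩ Y := Finset.mem_inter.2 ⟨h, Y3⟩
      rw [iXY] at this
      exact (Finset.mem_singleton.1 this).symm)
    have := weightSum_mono (a := a) (X := {b₂}) (X' := X \ Y) (Y := {b₃}) (Y' := Y \ X)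
      (by simp [X2, hb2]) (by simp [Y3, hb3])
    simpa [weightSum] using this
  have e4 : weightSum a {b₂, b₃} {b₂, b₃} = 2 * a b₂ b₃ := by
    rw [weightSum_insert_self hs h0 (by simpa using h₂₃)]
    simp [weightSum, h0]
  rw [iXY, Finset.card_singleton] at c1
  rw [iU, Finset.card_pair h₂₃] at c2
  rw [iU, e4] at e2
  have e5 : weightSum a {b₁} {b₁} = 0 := by simp [weightSum, h0]
  rw [iXY, e5] at e1
  have := hall ((X ∪ Y) ∪ W) (Finset.union_subset (Finset.union_subset hX hY) hW)
    (by simp [*]) (by simp [*]) (by simp [*])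
  omega

/-- The neighbors of a vertex in a simple graph, listed. -/
lemma exists_vertex_of_small_degree (hs : ∀ x y, a x y = a y x) (h0 : ∀ x, a x x = 0)
    {Z : Finset α} {s t : α} (hst : s ≠ t) (hsZ : s ∈ Z) (htZ : t ∈ Z) (hZ : 3 ≤ Z.card)
    (hsp : ∀ X ⊆ Z, 2 ≤ X.card → weightSum a X X + 6 ≤ 4 * X.card)
    (htight : weightSum a Z Z + 6 = 4 * Z.card) :
    ∃ z ∈ Z, z ≠ s ∧ z ≠ t ∧ (weightSum a {z} Z = 2 ∨ weightSum a {z} Z = 3) := by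
  have hdeg : ∀ z ∈ Z, 2 ≤ weightSum a {z} Z := by
    intro z hz
    have e1 := weightSum_erase_self hs h0 hz
    have e2 := Finset.card_erase_add_one hz
    have e3 := hsp (Z.erase z) (Finset.erase_subset _ _) (by omega)
    omega
  by_contra! hc
  have h4 : ∀ z ∈ (Z.erase s).erase t, 4 ≤ weightSum a {z} Z := by
    intro z hz
    simp only [Finset.mem_erase] at hz
    have := hc z hz.2.2 hz.2.1 hz.1
    have := hdeg z hz.2.2
    omega
  have htZ' : t ∈ Z.erase s := Finset.mem_erase.2 ⟨hst.symm, htZ⟩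
  have e1 := Finset.card_nsmul_le_sum _ _ 4 h4
  have e2 := Finset.sum_erase_add Z (fun z => weightSum a {z} Z) hsZ
  have e3 := Finset.sum_erase_add (Z.erase s) (fun z => weightSum a {z} Z) htZ'
  have e4 := weightSum_eq_sum_singleton (a := a) Z Z
  have e5 := Finset.card_erase_add_one hsZ
  have e6 := Finset.card_erase_add_one htZ'
  have := hdeg s hsZ
  have := hdeg t htZ
  simp only [smul_eq_mul] at e1
  omega

/-- A Laman graph has an ordering from `s` to `t` fulfilling all requirements except the upper
edge at `s`. -/
theorem exists_isBranching_of_laman (hs : ∀ x y, a x y = a y x) (h0 : ∀ x, a x x = 0)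
    {Z : Finset α} {s t : α} (hst : s ≠ t) (hsZ : s ∈ Z) (htZ : t ∈ Z)
    (hsp : ∀ X ⊆ Z, 2 ≤ X.card → weightSum a X X + 6 ≤ 4 * X.card)
    (htight : weightSum a Z Z + 6 = 4 * Z.card) :
    ∃ r u d, IsBranching a Z (fun v => v ≠ s ∧ v ≠ t) (· ≠ s) r u d := by
  have h2 : 2 ≤ Z.card := Finset.one_lt_card.2 ⟨s, hsZ, t, htZ, hst⟩
  induction hn : Z.card generalizing Z a with
  | zero => omega
  | succ n ih =>
  rcases (show Z.card = 2 ∨ 3 ≤ Z.card by omega) with hZ | hZ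
  · have hZe : Z = {s, t} := by
      refine (Finset.eq_of_subset_of_card_le ?_ ?_).symm
      · intro v hv
        simp only [Finset.mem_insert, Finset.mem_singleton] at hv
        rcases hv with rfl | rfl <;> assumption
      · rw [hZ, Finset.card_pair hst]
    have hpos : 0 < a t s := by
      have := weightSum_insert_self hs h0 (X := {t}) (z := s) (by simpa using hst)
      rw [← hZe] at this
      simp only [weightSum, Finset.sum_singleton, h0] at this htight
      rw [hs t s]
      omega
    subst hZe
    refine ⟨fun v => if v = s then 0 else 1, id, fun _ => s, ?_⟩
    constructor <;> simp <;> grind [Set.InjOn]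
  obtain ⟨z, hz, hzs, hzt, hdeg⟩ :=
    exists_vertex_of_small_degree hs h0 hst hsZ htZ hZ hsp htight
  have hone : ∀ x ∈ Z, ∀ y ∈ Z, a x y ≤ 1 := by
    intro x hx y hy
    by_cases hxy : x = y
    · simp [hxy, h0]
    have := hsp {x, y} (by intro v hv; simp only [Finset.mem_insert, Finset.mem_singleton] at hv
                           rcases hv with rfl | rfl <;> assumption) (by rw [Finset.card_pair hxy])
    rw [weightSum_insert_self hs h0 (by simpa using hxy), Finset.card_pair hxy] at this
    simp only [weightSum, Finset.sum_singleton, h0] at this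
    omega
  have hzE : z ∉ Z.erase z := Finset.notMem_erase z Z
  have hins : insert z (Z.erase z) = Z := Finset.insert_erase hz
  have hcE := Finset.card_erase_add_one hz
  have hwE := weightSum_erase_self hs h0 hz
  have hsE : s ∈ Z.erase z := Finset.mem_erase.2 ⟨hzs.symm, hsZ⟩
  have htE : t ∈ Z.erase z := Finset.mem_erase.2 ⟨hzt.symm, htZ⟩
  have hcard := card_filter_pos_eq_weightSum (hone z hz)
  have hnb : ∀ x, x ∈ (Z.filter fun y => 0 < a z y) → x ∈ Z.erase z ∧ 0 < a z x := by
    intro x hx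
    simp only [Finset.mem_filter] at hx
    refine ⟨Finset.mem_erase.2 ⟨?_, hx.1⟩, hx.2⟩
    rintro rfl
    simp [h0] at hx
  rcases hdeg with hdeg | hdeg
  · rw [hdeg] at hcard
    obtain ⟨x, y, hxy, hf⟩ := Finset.card_eq_two.1 hcard
    obtain ⟨hx, hax⟩ := hnb x (by simp [hf])
    obtain ⟨hy, hay⟩ := hnb y (by simp [hf])
    obtain ⟨r, u, d, hb⟩ := ih hs h0 hsE htE
      (fun X hX => hsp X (hX.trans (Finset.erase_subset _ _))) (by omega) (by omega) (by omega)
    obtain ⟨l, w, hl, hw, hal, haw, hlw⟩ : ∃ l w, l ∈ Z.erase z ∧ w ∈ Z.erase z ∧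
        0 < a z l ∧ 0 < a z w ∧ r l < r w := by
      rcases lt_or_gt_of_ne (fun e => hxy (hb.inj hx hy e)) with h | h
      · exact ⟨x, y, hx, hy, hax, hay, h⟩
      · exact ⟨y, x, hy, hx, hay, hax, h⟩
    have := hb.insert (a := a) (l := l) (m := l) (w := w) ∅ ∅ hzE hl hw le_rfl hlw hal haw
      (by simp) (by simp) (fun v hv hP _ => hb.up_adj v hv hP)
      (fun v hv hQ _ => hb.down_adj v hv hQ)
    rw [hins] at this
    exact ⟨_, _, _, this⟩
  · rw [hdeg] at hcard
    obtain ⟨b₁, b₂, b₃, h₁₂, h₁₃, h₂₃, hf⟩ := Finset.card_eq_three.1 hcard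
    obtain ⟨m₁, p₁⟩ := hnb b₁ (by simp [hf])
    obtain ⟨m₂, p₂⟩ := hnb b₂ (by simp [hf])
    obtain ⟨m₃, p₃⟩ := hnb b₃ (by simp [hf])
    obtain ⟨x, hx, y, hy, c, hc, hxy, hcx, hcy, hax, hay, hac, hadm⟩ :=
      exists_admissible_pair hs h0 hzE (by rwa [hins]) m₁ m₂ m₃ h₁₂ h₁₃ h₂₃ p₁ p₂ p₃
    have hw : ∀ X, weightSum (fun v w => a v w + pairWeight x y v w) X X =
        weightSum a X X + if x ∈ X ∧ y ∈ X then 2 else 0 := fun X => by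
      rw [weightSum_add, weightSum_pairWeight hxy]
    obtain ⟨r, u, d, hb⟩ := ih (a := fun v w => a v w + pairWeight x y v w)
      (fun v w => by rw [hs v w, pairWeight_symm])
      (fun v => by rw [h0, pairWeight_self hxy]) hsE htE
      (fun X hX hX2 => by
        rw [hw]
        split_ifs with h
        · have := hadm X hX h.1 h.2
          omega
        · exact hsp X (hX.trans (Finset.erase_subset _ _)) hX2)
      (by rw [hw, if_pos ⟨hx, hy⟩]; omega) (by omega) (by omega)
    have hba : ∀ v w, ¬(v = x ∧ w = y) → ¬(v = y ∧ w = x) →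
        0 < a v w + pairWeight x y v w → 0 < a v w := by
      intro v w n1 n2 h
      simpa [pairWeight, n1, n2] using h
    clear hadm hw
    wlog hr : r x < r y generalizing x y
    · have hr' : r y < r x := lt_of_le_of_ne (not_lt.1 hr) fun e => hxy (hb.inj hx hy e.symm)
      rw [pairWeight_comm] at hb hba
      exact this y hy x hx hxy.symm hcy hcx hay hax hb (fun v w n1 n2 => hba v w n2 n1) hr'
    have hrs : ∀ v ∈ Z.erase z, r s ≤ r v := fun v hv => by
      by_cases e : v = s
      · rw [e]
      · exact (hb.bottom_lt v hv e).le
    have hys : y ≠ s := by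
      rintro rfl
      have := hrs x hx
      omega
    have hcr : r c ≠ r x ∧ r c ≠ r y :=
      ⟨fun e => hcx (hb.inj hc hx e), fun e => hcy (hb.inj hc hy e)⟩
    have haxz : 0 < a x z := hs z x ▸ hax
    have hayz : 0 < a y z := hs z y ▸ hay
    by_cases hux : u x = y ∧ x ≠ s ∧ x ≠ t
    · have hdy : d y ≠ x := by
        have := hb.distinct x hx hux.2 (by rw [hux.1]; exact hys)
        rwa [hux.1] at this
      have hu : ∀ v ∈ Z.erase z, (v ≠ s ∧ v ≠ t) → v ∉ ({x} : Finset α) → 0 < a v (u v) := by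
        intro v hv hP hvx
        refine hba v (u v) (fun e => hvx (by simp [e.1])) (fun e => ?_) (hb.up_adj v hv hP)
        have := hb.up_lt v hv hP
        rw [e.2, e.1] at this
        omega
      have hd : ∀ v ∈ Z.erase z, v ≠ s → v ∉ (∅ : Finset α) → 0 < a v (d v) := by
        intro v hv hQ _
        refine hba v (d v) (fun e => ?_) (fun e => hdy (e.1 ▸ e.2)) (hb.down_adj v hv hQ)
        have := hb.down_lt v hv hQ
        rw [e.2, e.1] at this
        omega
      obtain ⟨l, m, w, hl, hw, hlm, hmw, hal, haw, hxm, hlx⟩ : ∃ l m w, l ∈ Z.erase z ∧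
          w ∈ Z.erase z ∧ r l ≤ r m ∧ r m < r w ∧ 0 < a z l ∧ 0 < a z w ∧
          r x ≤ r m ∧ x ≠ l := by
        rcases lt_or_gt_of_ne hcr.2 with h | h
        · rcases lt_or_gt_of_ne hcr.1 with h' | h'
          · exact ⟨c, x, y, hc, hy, h'.le, hr, hac, hay, le_rfl, hcx.symm⟩
          · exact ⟨c, c, y, hc, hy, le_rfl, h, hac, hay, h'.le, hcx.symm⟩
        · exact ⟨y, y, c, hy, hc, le_rfl, h, hay, hac, hr.le, hxy⟩
      have := hb.insert (a := a) {x} ∅ hzE hl hw hlm hmw hal haw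
        (by simp [hxm, haxz, hlx]) (by simp) hu hd
      rw [hins] at this
      exact ⟨_, _, _, this⟩
    · have hu : ∀ v ∈ Z.erase z, (v ≠ s ∧ v ≠ t) → v ∉ (∅ : Finset α) → 0 < a v (u v) := by
        intro v hv hP _
        refine hba v (u v) (fun e => hux ⟨e.1 ▸ e.2, e.1 ▸ hP⟩) (fun e => ?_) (hb.up_adj v hv hP)
        have := hb.up_lt v hv hP
        rw [e.2, e.1] at this
        omega
      have hd : ∀ v ∈ Z.erase z, v ≠ s → v ∉ ({y} : Finset α) → 0 < a v (d v) := by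
        intro v hv hQ hvy
        refine hba v (d v) (fun e => ?_) (fun e => hvy (by simp [e.1])) (hb.down_adj v hv hQ)
        have := hb.down_lt v hv hQ
        rw [e.2, e.1] at this
        omega
      obtain ⟨l, w, hl, hw, hlw, hal, haw, hly, hwy⟩ : ∃ l w, l ∈ Z.erase z ∧
          w ∈ Z.erase z ∧ r l < r w ∧ 0 < a z l ∧ 0 < a z w ∧ r l < r y ∧ y ≠ w := by
        rcases lt_or_gt_of_ne hcr.1 with h | h
        · exact ⟨c, x, hc, hx, h, hac, hax, h.trans hr, hxy.symm⟩
        · exact ⟨x, c, hx, hc, h, hax, hac, hr, hcy.symm⟩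
      have := hb.insert (a := a) ∅ {y} hzE hl hw le_rfl hlw hal haw
        (by simp) (by simp [hly, hayz, hwy]) hu hd
      rw [hins] at this
      exact ⟨_, _, _, this⟩

end Laman

section Expansion

variable {α β : Type*} [DecidableEq α] [DecidableEq β] {a : α → α → ℕ}

/-- Combine an ordering of the blocks of a partition of `Z` (the fibers of `q`) with orderings
of the individual blocks. The block `p` chooses the edge `U p` to a higher block
and the edge `D p` to a lower block. -/
lemma hasSTBranching_of_blocks {Z : Finset α} {s t : α} (q : α → β) (R : β → ℕ)
    (U D : β → α × α)
    (hR : ∀ v ∈ Z, ∀ w ∈ Z, R (q v) = R (q w) → q v = q w)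
    (hU : ∀ v ∈ Z, q v ≠ q t → q (U (q v)).1 = q v ∧ (U (q v)).2 ∈ Z ∧
      0 < a (U (q v)).1 (U (q v)).2 ∧ R (q v) < R (q (U (q v)).2))
    (hD : ∀ v ∈ Z, q v ≠ q s → q (D (q v)).1 = q v ∧ (D (q v)).2 ∈ Z ∧
      0 < a (D (q v)).1 (D (q v)).2 ∧ R (q (D (q v)).2) < R (q v))
    (hdist : ∀ v ∈ Z, ∀ w ∈ Z, q v ≠ q t → q w ≠ q s → D (q w) ≠ (U (q v)).swap)
    (hfib : ∀ v ∈ Z, HasSTBranching a (Z.filter fun w => q w = q v)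
      (if q v = q s then s else (D (q v)).1) (if q v = q t then t else (U (q v)).1)) :
    HasSTBranching a Z s t := by
  classical
  set bot : β → α := fun p => if p = q s then s else (D p).1 with hbot
  set top : β → α := fun p => if p = q t then t else (U p).1 with htop
  have hfib' : ∀ p : β, ∃ r u d, p ∈ Z.image q →
      IsBranching a (Z.filter fun w => q w = p) (· ≠ top p) (· ≠ bot p) r u d := by
    intro p
    by_cases hp : p ∈ Z.image q
    · obtain ⟨v, hv, rfl⟩ := Finset.mem_image.1 hp
      obtain ⟨r, u, d, h⟩ := hfib v hv
      exact ⟨r, u, d, fun _ => h⟩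
    · exact ⟨fun _ => 0, id, id, fun h => absurd h hp⟩
  choose r u d hb using hfib'
  have hb' : ∀ v ∈ Z, IsBranching a (Z.filter fun w => q w = q v) (· ≠ top (q v))
      (· ≠ bot (q v)) (r (q v)) (u (q v)) (d (q v)) :=
    fun v hv => hb (q v) (Finset.mem_image_of_mem q hv)
  obtain ⟨N, hN⟩ : ∃ N, ∀ v ∈ Z, r (q v) v < N :=
    ⟨∑ v ∈ Z, r (q v) v + 1, fun v hv => Nat.lt_succ_of_le
      (Finset.single_le_sum (f := fun v => r (q v) v) (fun _ _ => Nat.zero_le _) hv)⟩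
  have hlex : ∀ v ∈ Z, ∀ w ∈ Z, R (q v) < R (q w) →
      N * R (q v) + r (q v) v < N * R (q w) + r (q w) w := by
    intro v hv w _ h
    have h1 := hN v hv
    have h2 : N * (R (q v) + 1) ≤ N * R (q w) := Nat.mul_le_mul_left N h
    rw [Nat.mul_add, Nat.mul_one] at h2
    omega
  have hmem : ∀ v ∈ Z, v ∈ Z.filter fun w => q w = q v := fun v hv =>
    Finset.mem_filter.2 ⟨hv, rfl⟩
  have hupq : ∀ v ∈ Z, v ≠ top (q v) → u (q v) v ∈ Z ∧ q (u (q v) v) = q v := fun v hv h =>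
    Finset.mem_filter.1 ((hb' v hv).up_mem v (hmem v hv) h)
  have hdnq : ∀ v ∈ Z, v ≠ bot (q v) → d (q v) v ∈ Z ∧ q (d (q v) v) = q v := fun v hv h =>
    Finset.mem_filter.1 ((hb' v hv).down_mem v (hmem v hv) h)
  have htopv : ∀ v, v ≠ t → v = top (q v) → q v ≠ q t ∧ v = (U (q v)).1 := by
    intro v hvt hv
    by_cases e : q v = q t
    · rw [htop] at hv
      simp only [e, if_true] at hv
      exact absurd hv hvt
    · rw [htop] at hv
      simp only [e, if_false] at hv
      exact ⟨e, hv⟩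
  have hbotv : ∀ v, v ≠ s → v = bot (q v) → q v ≠ q s ∧ v = (D (q v)).1 := by
    intro v hvt hv
    by_cases e : q v = q s
    · rw [hbot] at hv
      simp only [e, if_true] at hv
      exact absurd hv hvt
    · rw [hbot] at hv
      simp only [e, if_false] at hv
      exact ⟨e, hv⟩
  refine ⟨fun v => N * R (q v) + r (q v) v,
    fun v => if v = top (q v) then (U (q v)).2 else u (q v) v,
    fun v => if v = bot (q v) then (D (q v)).2 else d (q v) v, ?_, ?_, ?_, ?_, ?_, ?_, ?_, ?_⟩
  · intro v hv w hw h
    simp only at h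
    have e : q v = q w := by
      refine hR v hv w hw (le_antisymm ?_ ?_) <;> by_contra! hlt
      · have := hlex w hw v hv hlt
        omega
      · have := hlex v hv w hw hlt
        omega
    rw [e] at h
    refine (hb' w hw).inj ?_ ?_ (Nat.add_left_cancel h)
    · simpa [e] using hv
    · simpa using hw
  all_goals intro v hv hne
  · split_ifs with h
    · exact (hU v hv (htopv v hne h).1).2.1
    · exact (hupq v hv h).1
  · split_ifs with h
    · obtain ⟨h1, h2⟩ := htopv v hne h
      have := (hU v hv h1).2.2.1
      rwa [← h2] at this
    · exact (hb' v hv).up_adj v (hmem v hv) h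
  · split_ifs with h
    · obtain ⟨h1, h2⟩ := htopv v hne h
      have := hU v hv h1
      exact hlex v hv _ this.2.1 this.2.2.2
    · rw [(hupq v hv h).2]
      exact Nat.add_lt_add_left ((hb' v hv).up_lt v (hmem v hv) h) _
  · split_ifs with h
    · exact (hD v hv (hbotv v hne h).1).2.1
    · exact (hdnq v hv h).1
  · split_ifs with h
    · obtain ⟨h1, h2⟩ := hbotv v hne h
      have := (hD v hv h1).2.2.1
      rwa [← h2] at this
    · exact (hb' v hv).down_adj v (hmem v hv) h
  · split_ifs with h
    · obtain ⟨h1, h2⟩ := hbotv v hne h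
      have := hD v hv h1
      exact hlex _ this.2.1 v hv this.2.2.2
    · rw [(hdnq v hv h).2]
      exact Nat.add_lt_add_left ((hb' v hv).down_lt v (hmem v hv) h) _
  · intro hws heq
    by_cases h : v = top (q v)
    · rw [if_pos h] at hws heq
      obtain ⟨h1, h2⟩ := htopv v hne h
      obtain ⟨k1, k2, k3, k4⟩ := hU v hv h1
      set w := (U (q v)).2 with hw
      by_cases h' : w = bot (q w)
      · rw [if_pos h'] at heq
        obtain ⟨j1, j2⟩ := hbotv w hws h'
        exact hdist v hv w k2 h1 j1 (Prod.ext (by rw [← j2]; rfl) (by rw [heq, Prod.snd_swap, ← h2]))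
      · rw [if_neg h'] at heq
        have := (hdnq w k2 h').2
        rw [heq] at this
        rw [this] at k4
        exact lt_irrefl _ k4
    · rw [if_neg h] at hws heq
      obtain ⟨k1, k2⟩ := hupq v hv h
      rw [k2] at heq
      by_cases h' : u (q v) v = bot (q v)
      · rw [if_pos h'] at heq
        obtain ⟨j1, j2⟩ := hbotv _ hws (by rw [k2]; exact h')
        have := (hD _ k1 j1).2.2.2
        rw [k2, heq] at this
        exact lt_irrefl _ this
      · rw [if_neg h'] at heq
        exact (hb' v hv).distinct v (hmem v hv) h h' heq

end Expansion

/-- A weighted set is tight if it spans as many edges as two edge-disjoint spanning trees. -/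
def IsTight {α : Type*} (a : α → α → ℕ) (X : Finset α) : Prop :=
  weightSum a X X + 4 = 4 * X.card

/-- A simple `(2,2)`-sparse graph of maximum degree at most 4 in which no tight set arises from
another one by adding a vertex. -/
structure IsNormalSparse {α : Type*} [DecidableEq α] (a : α → α → ℕ) : Prop where
  symm : ∀ x y, a x y = a y x
  irrefl : ∀ x, a x x = 0
  le_one : ∀ x y, a x y ≤ 1
  degree_le : ∀ x X, weightSum a {x} X ≤ 4
  sparse : ∀ X : Finset α, X.Nonempty → weightSum a X X + 4 ≤ 4 * X.card
  not_tight_erase : ∀ X, ∀ x ∈ X, 2 ≤ X.card → IsTight a X → ¬ IsTight a (X.erase x)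

namespace IsNormalSparse

variable {α : Type*} [DecidableEq α] {a : α → α → ℕ}

lemma sparse_of_not_tight (ha : IsNormalSparse a) {X : Finset α} (hX : X.Nonempty)
    (ht : ¬ IsTight a X) : weightSum a X X + 6 ≤ 4 * X.card := by
  obtain ⟨k, hk⟩ := even_weightSum_self ha.symm ha.irrefl X
  have := ha.sparse X hX
  unfold IsTight at ht
  omega

lemma three_le_degree (ha : IsNormalSparse a) {X : Finset α} (hX : IsTight a X)
    (h2 : 2 ≤ X.card) {x : α} (hx : x ∈ X) : 3 ≤ weightSum a {x} X := by
  have e1 := weightSum_erase_self ha.symm ha.irrefl hx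
  have e2 := Finset.card_erase_add_one hx
  have e3 := ha.sparse_of_not_tight (Finset.card_pos.1 (by omega))
    (ha.not_tight_erase X x hx h2 hX)
  unfold IsTight at hX
  omega

lemma out_degree_le_one (ha : IsNormalSparse a) {X Y : Finset α} (hX : IsTight a X)
    (h2 : 2 ≤ X.card) (hd : Disjoint X Y) {x : α} (hx : x ∈ X) : weightSum a {x} Y ≤ 1 := by
  have e1 := ha.three_le_degree hX h2 hx
  have e2 := ha.degree_le x (X ∪ Y)
  rw [weightSum_union_right hd] at e2
  omega

lemma exists_matching_pair (ha : IsNormalSparse a) {X Y : Finset α} (hX : IsTight a X)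
    (hY : IsTight a Y) (hX2 : 2 ≤ X.card) (hY2 : 2 ≤ Y.card) (hd : Disjoint X Y)
    (h : 2 ≤ weightSum a X Y) :
    ∃ x₁ ∈ X, ∃ x₂ ∈ X, ∃ y₁ ∈ Y, ∃ y₂ ∈ Y, x₁ ≠ x₂ ∧ y₁ ≠ y₂ ∧ 0 < a x₁ y₁ ∧ 0 < a x₂ y₂ := by
  obtain ⟨x₁, hx₁, y₁, hy₁, h₁⟩ := exists_pos_of_weightSum_pos (a := a) (X := X) (Y := Y) (by omega)
  have e1 := ha.out_degree_le_one hX hX2 hd hx₁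
  have e2 : weightSum a {x₁} Y + weightSum a (X.erase x₁) Y = weightSum a X Y := by
    rw [← weightSum_union_left (by simp), ← Finset.insert_eq, Finset.insert_erase hx₁]
  obtain ⟨x₂, hx₂, y₂, hy₂, h₂⟩ :=
    exists_pos_of_weightSum_pos (a := a) (X := X.erase x₁) (Y := Y) (by omega)
  obtain ⟨hne, hx₂⟩ := Finset.mem_erase.1 hx₂
  refine ⟨x₁, hx₁, x₂, hx₂, y₁, hy₁, y₂, hy₂, hne.symm, ?_, h₁, h₂⟩
  rintro rfl
  have := ha.out_degree_le_one hY hY2 hd.symm hy₁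
  have := two_le_weightSum_singleton (a := a) hx₁ hx₂ hne.symm (x := y₁)
    (by rwa [ha.symm]) (by rwa [ha.symm])
  omega

lemma isTight_union (ha : IsNormalSparse a) {X Y : Finset α} (hX : IsTight a X)
    (hY : IsTight a Y) (hne : (X ∩ Y).Nonempty) : IsTight a (X ∪ Y) ∧ IsTight a (X ∩ Y) := by
  have e1 := weightSum_union_add_inter ha.symm X Y
  have e2 := ha.sparse _ hne
  have e3 := ha.sparse (X ∪ Y) (hne.mono (Finset.inter_subset_left.trans Finset.subset_union_left))
  have e4 := Finset.card_union_add_card_inter X Y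
  unfold IsTight at *
  omega

lemma isTight_sdiff_of_crossing (ha : IsNormalSparse a) {X Y : Finset α} (hX : IsTight a X)
    (hY : IsTight a Y) (hne : (X ∩ Y).Nonempty) (hXY : (X \ Y).Nonempty)
    (hYX : (Y \ X).Nonempty) : IsTight a (Y \ X) := by
  have e1 := (ha.isTight_union hX hY hne).2
  have e2 := weightSum_sdiff_self ha.symm (Finset.inter_subset_left : X ∩ Y ⊆ X)
  have e3 := weightSum_sdiff_self ha.symm (Finset.inter_subset_right : X ∩ Y ⊆ Y)
  rw [Finset.sdiff_inter_self_left] at e2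
  rw [Finset.sdiff_inter_self_right] at e3
  have e4 := ha.sparse _ hXY
  have e5 := ha.sparse _ hYX
  have c1 := Finset.card_sdiff_add_card_inter X Y
  have c2 := Finset.card_sdiff_add_card_inter Y X
  rw [Finset.inter_comm Y X] at c2
  have e6 : weightSum a (X ∩ Y) ((X ∩ Y) ∪ ((X \ Y) ∪ (Y \ X))) ≤ (X ∩ Y).card * 4 := by
    rw [weightSum_eq_sum_singleton]
    exact Finset.sum_le_card_nsmul _ _ _ fun x _ => ha.degree_le x _
  rw [weightSum_union_right, weightSum_union_right disjoint_sdiff_sdiff] at e6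
  · unfold IsTight at *
    omega
  · rw [Finset.disjoint_left]
    intro v hv
    simp only [Finset.mem_inter] at hv
    simp [hv.1, hv.2]

lemma isTight_sdiff_of_mem (ha : IsNormalSparse a) {Z X : Finset α} (hZ : IsTight a Z)
    (hX : IsTight a X) (hXZ : X ⊂ Z) {s t : α} (hst : s ≠ t) (hs : s ∈ X) (ht : t ∈ X)
    (hs3 : weightSum a {s} Z ≤ 3) (ht3 : weightSum a {t} Z ≤ 3) : IsTight a (Z \ X) := by
  have htX : t ∈ X.erase s := Finset.mem_erase.2 ⟨hst.symm, ht⟩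
  have e1 := Finset.sum_le_card_nsmul ((X.erase s).erase t) (fun z => weightSum a {z} Z) 4
    (fun x _ => ha.degree_le x Z)
  have e2 := Finset.sum_erase_add X (fun z => weightSum a {z} Z) hs
  have e3 := Finset.sum_erase_add (X.erase s) (fun z => weightSum a {z} Z) htX
  have e4 := weightSum_eq_sum_singleton (a := a) X Z
  have e5 := Finset.card_erase_add_one hs
  have e6 := Finset.card_erase_add_one htX
  have e7 := weightSum_sdiff_right (a := a) hXZ.1 X
  have e8 := weightSum_sdiff_self ha.symm hXZ.1
  have e9 := ha.sparse (Z \ X) (Finset.sdiff_nonempty.2 hXZ.2)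
  have e10 := Finset.card_sdiff_add_card_eq_card hXZ.1
  simp only [smul_eq_mul] at e1
  unfold IsTight at *
  omega

/-- Insert a tight set `Y` into an ordering of a tight set `X`. -/
lemma hasSTBranching_union (ha : IsNormalSparse a) {X Y : Finset α} (hX : IsTight a X)
    (hY : IsTight a Y) (hX2 : 2 ≤ X.card) (hY2 : 2 ≤ Y.card) (hd : Disjoint X Y)
    (h : 2 ≤ weightSum a X Y) {s t : α} (hs : s ∈ X) (ht : t ∈ X)
    (hXb : HasSTBranching a X s t)
    (hYb : ∀ y ∈ Y, ∀ y' ∈ Y, y ≠ y' → weightSum a {y} Y ≤ 3 → weightSum a {y'} Y ≤ 3 →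
      HasSTBranching a Y y y') :
    HasSTBranching a (X ∪ Y) s t := by
  obtain ⟨r, u, d, hb⟩ := hXb
  obtain ⟨x₁, hx₁, x₂, hx₂, y₁, hy₁, y₂, hy₂, hy, hlt, h₁, h₂⟩ : ∃ x₁ ∈ X, ∃ x₂ ∈ X, ∃ y₁ ∈ Y,
      ∃ y₂ ∈ Y, y₁ ≠ y₂ ∧ r x₁ < r x₂ ∧ 0 < a x₁ y₁ ∧ 0 < a x₂ y₂ := by
    obtain ⟨x₁, hx₁, x₂, hx₂, y₁, hy₁, y₂, hy₂, hx, hy, h₁, h₂⟩ :=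
      ha.exists_matching_pair hX hY hX2 hY2 hd h
    rcases lt_or_gt_of_ne (fun e => hx (hb.inj hx₁ hx₂ e)) with hlt | hlt
    · exact ⟨x₁, hx₁, x₂, hx₂, y₁, hy₁, y₂, hy₂, hy, hlt, h₁, h₂⟩
    · exact ⟨x₂, hx₂, x₁, hx₁, y₂, hy₂, y₁, hy₁, hy.symm, hlt, h₂, h₁⟩
  have hdeg : ∀ x ∈ X, ∀ y ∈ Y, 0 < a x y → weightSum a {y} Y ≤ 3 := by
    intro x hx y _ hxy
    have e1 := ha.degree_le y (Y ∪ X)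
    rw [weightSum_union_right hd.symm] at e1
    have e2 := one_le_weightSum_singleton (a := a) hx (x := y) (by rwa [ha.symm])
    omega
  have hYbr := hYb y₁ hy₁ y₂ hy₂ hy (hdeg _ hx₁ _ hy₁ h₁) (hdeg _ hx₂ _ hy₂ h₂)
  have hXY : ∀ v ∈ X, v ∉ Y := fun v hv => Finset.disjoint_left.1 hd hv
  have hneq : ∀ v ∈ X, v ≠ y₁ := fun v hv e => hXY v hv (e ▸ hy₁)
  have qX : ∀ v ∈ X, (if v ∈ Y then y₁ else v) = v := fun v hv => if_neg (hXY v hv)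
  have qY : ∀ v ∈ Y, (if v ∈ Y then y₁ else v) = y₁ := fun v hv => if_pos hv
  refine hasSTBranching_of_blocks (fun v => if v ∈ Y then y₁ else v)
    (fun p => if p = y₁ then 2 * r x₁ + 1 else 2 * r p)
    (fun p => if p = y₁ then (y₂, x₂) else (p, u p))
    (fun p => if p = y₁ then (y₁, x₁) else (p, d p)) ?_ ?_ ?_ ?_ ?_
  · intro v hv w hw
    rcases Finset.mem_union.1 hv with hv | hv <;> rcases Finset.mem_union.1 hw with hw | hw
    · simp only [qX v hv, qX w hw, hneq v hv, hneq w hw, if_false]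
      exact fun e => hb.inj hv hw (by omega)
    · simp only [qX v hv, qY w hw, hneq v hv, if_false, if_true]
      intro e
      omega
    · simp only [qX w hw, qY v hv, hneq w hw, if_false, if_true]
      intro e
      omega
    · simp only [qY w hw, qY v hv, implies_true]
  · intro v hv hne
    rcases Finset.mem_union.1 hv with hv | hv
    · simp only [qX v hv, qX t ht] at hne
      have hm := hb.up_mem v hv hne
      simp only [qX v hv, hneq v hv, if_false, qX _ hm, hneq _ hm, Finset.mem_union, hm,
        true_or, true_and]
      have := hb.up_lt v hv hne
      exact ⟨hb.up_adj v hv hne, by omega⟩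
    · simp only [qY v hv, if_true, qX _ hx₂, qY _ hy₂, hneq _ hx₂, if_false, Finset.mem_union, hx₂,
        true_or, true_and]
      exact ⟨by rwa [ha.symm], by omega⟩
  · intro v hv hne
    rcases Finset.mem_union.1 hv with hv | hv
    · simp only [qX v hv, qX s hs] at hne
      have hm := hb.down_mem v hv hne
      simp only [qX v hv, hneq v hv, if_false, qX _ hm, hneq _ hm, Finset.mem_union, hm,
        true_or, true_and]
      have := hb.down_lt v hv hne
      exact ⟨hb.down_adj v hv hne, by omega⟩
    · simp only [qY v hv, if_true, qX _ hx₁, qY _ hy₁, hneq _ hx₁, if_false, Finset.mem_union, hx₁,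
        true_or, true_and]
      exact ⟨by rwa [ha.symm], by omega⟩
  · intro v hv w hw hvt hws
    rcases Finset.mem_union.1 hv with hv | hv <;> rcases Finset.mem_union.1 hw with hw | hw
    · simp only [qX v hv, qX t ht] at hvt
      simp only [qX w hw, qX s hs] at hws
      simp only [qX v hv, qX w hw, hneq v hv, hneq w hw, if_false, Prod.swap_prod_mk, ne_eq,
        Prod.mk.injEq]
      rintro ⟨rfl, e⟩
      exact hb.distinct v hv hvt hws e
    · simp only [qX v hv, qX t ht] at hvt
      simp only [qX v hv, qY w hw, hneq v hv, if_false, if_true, Prod.swap_prod_mk, ne_eq,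
        Prod.mk.injEq]
      exact fun e => hneq _ (hb.up_mem v hv hvt) e.1.symm
    · simp only [qX w hw, qX s hs] at hws
      simp only [qX w hw, qY v hv, hneq w hw, if_false, if_true, Prod.swap_prod_mk, ne_eq,
        Prod.mk.injEq]
      exact fun e => hXY _ (hb.down_mem w hw hws) (e.2 ▸ hy₂)
    · simp only [qY w hw, qY v hv, if_true, Prod.swap_prod_mk, ne_eq, Prod.mk.injEq]
      exact fun e => hneq _ hx₂ e.1.symm
  · intro v hv
    rcases Finset.mem_union.1 hv with hv | hv
    · have hf : ((X ∪ Y).filter fun w => (if w ∈ Y then y₁ else w) = v) = {v} := by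
        ext w
        simp only [Finset.mem_filter, Finset.mem_union, Finset.mem_singleton]
        constructor
        · rintro ⟨hw | hw, e⟩
          · rwa [qX w hw] at e
          · rw [qY w hw] at e
            exact absurd e.symm (hneq v hv)
        · rintro rfl
          exact ⟨Or.inl hv, qX w hv⟩
      have b1 : (if v = s then s else v) = v := by split_ifs with e; exacts [e.symm, rfl]
      have b2 : (if v = t then t else v) = v := by split_ifs with e; exacts [e.symm, rfl]
      simp only [qX v hv, qX s hs, qX t ht, hneq v hv, if_false, hf, b1, b2]
      exact hasSTBranching_singleton v
    · have hf : ((X ∪ Y).filter fun w => (if w ∈ Y then y₁ else w) = y₁) = Y := by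
        ext w
        simp only [Finset.mem_filter, Finset.mem_union]
        constructor
        · rintro ⟨hw | hw, e⟩
          · rw [qX w hw] at e
            exact absurd e (hneq w hw)
          · exact hw
        · intro hw
          exact ⟨Or.inr hw, qY w hw⟩
      simp only [qY v hv, qX s hs, qX t ht, (hneq s hs).symm, (hneq t ht).symm, if_false, if_true,
        hf]
      exact hYbr

end IsNormalSparse

lemma weightSum_biUnion {α : Type*} [DecidableEq α] {a : α → α → ℕ} {S : Finset (Finset α)}
    (hS : (S : Set (Finset α)).PairwiseDisjoint id) :
    weightSum a (S.biUnion id) (S.biUnion id) = ∑ p ∈ S, ∑ p' ∈ S, weightSum a p p' := by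
  unfold weightSum
  rw [Finset.sum_biUnion hS]
  refine Finset.sum_congr rfl fun p _ => ?_
  exact (Finset.sum_congr rfl fun x _ => Finset.sum_biUnion hS).trans Finset.sum_comm

/-- The weight between distinct sets, as a weight function on sets. -/
def blockWeight {α : Type*} [DecidableEq α] (a : α → α → ℕ) (p p' : Finset α) : ℕ :=
  if p = p' then 0 else weightSum a p p'

lemma weightSum_blockWeight {α : Type*} [DecidableEq α] {a : α → α → ℕ} {S : Finset (Finset α)}
    (hS : (S : Set (Finset α)).PairwiseDisjoint id) :
    weightSum (blockWeight a) S S + ∑ p ∈ S, weightSum a p p =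
      weightSum a (S.biUnion id) (S.biUnion id) := by
  rw [weightSum_biUnion hS, weightSum, ← Finset.sum_add_distrib]
  refine Finset.sum_congr rfl fun p hp => ?_
  have : ∀ p', weightSum a p p' = blockWeight a p p' + if p = p' then weightSum a p p else 0 := by
    intro p'
    unfold blockWeight
    split_ifs with h
    · rw [h, zero_add]
    · rw [add_zero]
  rw [Finset.sum_congr rfl fun p' _ => this p', Finset.sum_add_distrib, Finset.sum_ite_eq,
    if_pos hp]

/-- `q` assigns to every element of `Z` the block of a partition of `Z` into tight sets. -/
def IsTightPartition {α : Type*} (a : α → α → ℕ) (Z : Finset α) (q : α → Finset α) :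
    Prop :=
  ∀ v ∈ Z, v ∈ q v ∧ q v ⊆ Z ∧ IsTight a (q v) ∧ ∀ w ∈ q v, q w = q v

namespace IsTightPartition

variable {α : Type*} [DecidableEq α] {a : α → α → ℕ} {Z : Finset α} {q : α → Finset α}

lemma eq_of_mem (hq : IsTightPartition a Z q) {p : Finset α} (hp : p ∈ Z.image q) {x : α}
    (hx : x ∈ p) : x ∈ Z ∧ q x = p := by
  obtain ⟨v, hv, rfl⟩ := Finset.mem_image.1 hp
  exact ⟨(hq v hv).2.1 hx, (hq v hv).2.2.2 x hx⟩

lemma pairwiseDisjoint (hq : IsTightPartition a Z q) {S : Finset (Finset α)}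
    (hS : S ⊆ Z.image q) : (S : Set (Finset α)).PairwiseDisjoint id := by
  intro p hp p' hp' hne
  refine Finset.disjoint_left.2 fun x hx hx' => hne ?_
  rw [← (hq.eq_of_mem (hS hp) hx).2, (hq.eq_of_mem (hS hp') hx').2]

lemma sum_weightSum (hq : IsTightPartition a Z q) {S : Finset (Finset α)}
    (hS : S ⊆ Z.image q) :
    ∑ p ∈ S, weightSum a p p + 4 * S.card = 4 * (S.biUnion id).card := by
  have h : ∑ p ∈ S, weightSum a p p + 4 * S.card = ∑ p ∈ S, (weightSum a p p + 4) := by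
    rw [Finset.sum_add_distrib, Finset.sum_const, smul_eq_mul, mul_comm]
  rw [h, Finset.card_biUnion (hq.pairwiseDisjoint hS), Finset.mul_sum]
  refine Finset.sum_congr rfl fun p hp => ?_
  obtain ⟨v, hv, rfl⟩ := Finset.mem_image.1 (hS hp)
  exact (hq v hv).2.2.1

lemma biUnion_eq (hq : IsTightPartition a Z q) : (Z.image q).biUnion id = Z := by
  ext x
  simp only [Finset.mem_biUnion, id]
  exact ⟨fun ⟨p, hp, hx⟩ => (hq.eq_of_mem hp hx).1,
    fun hx => ⟨q x, Finset.mem_image_of_mem q hx, (hq x hx).1⟩⟩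

end IsTightPartition

namespace IsNormalSparse

variable {α : Type*} [DecidableEq α] {a : α → α → ℕ}

/-- An edge joining two blocks can be removed so that the quotient becomes a Laman graph. -/
lemma exists_block_ordering (ha : IsNormalSparse a) {Z : Finset α} {q : α → Finset α}
    (hZ : IsTight a Z) (hq : IsTightPartition a Z q)
    (hun : ∀ S ⊆ Z.image q, 2 ≤ S.card → S ≠ Z.image q → ¬ IsTight a (S.biUnion id))
    {s t x₀ y₀ : α} (hs : s ∈ Z) (ht : t ∈ Z) (hst : q s ≠ q t) (hx₀ : x₀ ∈ Z) (hy₀ : y₀ ∈ Z)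
    (hne : q x₀ ≠ q y₀) (h₀ : 0 < a x₀ y₀) :
    ∃ (r : Finset α → ℕ) (u d : Finset α → Finset α),
      IsBranching (blockWeight fun x y => a x y - pairWeight x₀ y₀ x y) (Z.image q)
        (fun p => p ≠ q s ∧ p ≠ q t) (· ≠ q s) r u d := by
  have hxy : x₀ ≠ y₀ := fun e => hne (by rw [e])
  set a' : α → α → ℕ := fun x y => a x y - pairWeight x₀ y₀ x y with ha'
  have hsymm : ∀ x y, a' x y = a' y x := fun x y => by
    simp only [ha', ha.symm x y, pairWeight_symm x₀ y₀ x y]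
  have hsplit : ∀ X, weightSum a X X =
      weightSum a' X X + if x₀ ∈ X ∧ y₀ ∈ X then 2 else 0 := by
    intro X
    rw [← weightSum_pairWeight hxy, ← weightSum_add]
    congr 1
    funext x y
    simp only [ha']
    have : pairWeight x₀ y₀ x y ≤ a x y := by
      unfold pairWeight
      split_ifs with h
      · rcases h with ⟨rfl, rfl⟩ | ⟨rfl, rfl⟩
        · exact h₀
        · rw [ha.symm]
          exact h₀
      · exact Nat.zero_le _
    omega
  have hblock : ∀ S ⊆ Z.image q, ∑ p ∈ S, weightSum a' p p = ∑ p ∈ S, weightSum a p p := by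
    intro S hS
    refine Finset.sum_congr rfl fun p hp => ?_
    rw [hsplit p, if_neg, add_zero]
    rintro ⟨h1, h2⟩
    exact hne ((hq.eq_of_mem (hS hp) h1).2.trans (hq.eq_of_mem (hS hp) h2).2.symm)
  have hsum : ∀ S ⊆ Z.image q, weightSum (blockWeight a') S S + 4 * (S.biUnion id).card =
      weightSum a' (S.biUnion id) (S.biUnion id) + 4 * S.card := by
    intro S hS
    have e1 := weightSum_blockWeight (a := a') (hq.pairwiseDisjoint hS)
    have e2 := hq.sum_weightSum hS
    rw [hblock S hS] at e1
    omega
  have hall := hsum _ (Finset.Subset.refl _)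
  rw [hq.biUnion_eq] at hall
  have hZs := hsplit Z
  rw [if_pos ⟨hx₀, hy₀⟩] at hZs
  unfold IsTight at hZ
  refine exists_isBranching_of_laman (fun p p' => ?_) (fun p => ?_) hst
    (Finset.mem_image_of_mem q hs) (Finset.mem_image_of_mem q ht) (fun S hS hS2 => ?_) (by omega)
  · unfold blockWeight
    by_cases h : p = p'
    · rw [h]
    · rw [if_neg h, if_neg (Ne.symm h), weightSum_comm hsymm]
  · simp [blockWeight]
  · by_cases hS' : S = Z.image q
    · subst hS'
      omega
    · have e1 := hsum S hS
      have e2 := hsplit (S.biUnion id)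
      obtain ⟨p, hp⟩ := Finset.card_pos.1 (show 0 < S.card by omega)
      obtain ⟨v, hv, rfl⟩ := Finset.mem_image.1 (hS hp)
      have e3 := ha.sparse_of_not_tight ⟨v, Finset.mem_biUnion.2 ⟨_, hp, (hq v hv).1⟩⟩
        (hun S hS hS2 hS')
      omega

lemma hasSTBranching_of_tightPartition (ha : IsNormalSparse a) {Z : Finset α}
    {q : α → Finset α} (hZ : IsTight a Z) (hq : IsTightPartition a Z q)
    (hun : ∀ S ⊆ Z.image q, 2 ≤ S.card → S ≠ Z.image q → ¬ IsTight a (S.biUnion id))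
    {s t : α} (hs : s ∈ Z) (ht : t ∈ Z) (hst : q s ≠ q t)
    (hs3 : weightSum a {s} Z ≤ 3) (ht3 : weightSum a {t} Z ≤ 3)
    (ih : ∀ Y ⊂ Z, IsTight a Y → ∀ x ∈ Y, ∀ y ∈ Y, x ≠ y → weightSum a {x} Y ≤ 3 →
      weightSum a {y} Y ≤ 3 → HasSTBranching a Y x y) :
    HasSTBranching a Z s t := by
  classical
  obtain ⟨s₀, hs₀, y₀, hy₀, h₀⟩ : ∃ x ∈ q s, ∃ y ∈ Z \ q s, 0 < a x y := by
    refine exists_pos_of_weightSum_pos ?_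
    have e1 := weightSum_sdiff_self ha.symm (hq s hs).2.1
    have e2 := (hq s hs).2.2.1
    have e3 := ha.sparse (Z \ q s) ⟨t, by
      simp only [Finset.mem_sdiff, ht, true_and]
      exact fun h => hst ((hq s hs).2.2.2 t h).symm⟩
    have e4 := Finset.card_sdiff_add_card_eq_card (hq s hs).2.1
    unfold IsTight at *
    omega
  obtain ⟨hy₀Z, hy₀s⟩ := Finset.mem_sdiff.1 hy₀
  have hs₀Z : s₀ ∈ Z := (hq s hs).2.1 hs₀
  have hqs₀ : q s₀ = q s := (hq s hs).2.2.2 s₀ hs₀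
  have hqy₀ : q y₀ ≠ q s := fun e => hy₀s (e ▸ (hq y₀ hy₀Z).1)
  obtain ⟨r, u, d, hb⟩ := ha.exists_block_ordering hZ hq hun hs ht hst hs₀Z hy₀Z
    (by rw [hqs₀]; exact hqy₀.symm) h₀
  have hmem : ∀ v ∈ Z, q v ∈ Z.image q := fun v hv => Finset.mem_image_of_mem q hv
  have hlift : ∀ p p' : Finset α, ∃ e : α × α,
      0 < blockWeight (fun x y => a x y - pairWeight s₀ y₀ x y) p p' →
        e.1 ∈ p ∧ e.2 ∈ p' ∧ 0 < a e.1 e.2 ∧ e ≠ (y₀, s₀) := by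
    intro p p'
    by_cases h : 0 < blockWeight (fun x y => a x y - pairWeight s₀ y₀ x y) p p'
    · have h' := h
      unfold blockWeight at h'
      split_ifs at h' with hpp
      · omega
      · obtain ⟨x, hx, y, hy, hxy⟩ := exists_pos_of_weightSum_pos h'
        refine ⟨(x, y), fun _ => ⟨hx, hy, by simp only; omega, ?_⟩⟩
        intro e
        obtain ⟨rfl, rfl⟩ := Prod.mk.inj e
        have := ha.le_one x y
        simp only [pairWeight, and_self, or_true, if_true] at hxy
        omega
    · exact ⟨(s, s), fun h' => absurd h' h⟩
  choose lift hl using hlift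
  set U : Finset α → α × α := fun p => if p = q s then (s₀, y₀) else lift p (u p) with hU
  set D : Finset α → α × α := fun p => lift p (d p) with hD
  have hUp : ∀ v ∈ Z, q v ≠ q t → (U (q v)).1 ∈ q v ∧ (U (q v)).2 ∈ Z ∧
      0 < a (U (q v)).1 (U (q v)).2 ∧ r (q v) < r (q (U (q v)).2) := by
    intro v hv hvt
    simp only [hU]
    split_ifs with h
    · rw [h]
      exact ⟨hs₀, hy₀Z, h₀, hb.bottom_lt _ (hmem _ hy₀Z) hqy₀⟩
    · have e1 := hb.up_mem _ (hmem v hv) ⟨h, hvt⟩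
      have e2 := hb.up_lt _ (hmem v hv) ⟨h, hvt⟩
      obtain ⟨h1, h2, h3, -⟩ := hl _ _ (hb.up_adj _ (hmem v hv) ⟨h, hvt⟩)
      obtain ⟨h4, h5⟩ := hq.eq_of_mem e1 h2
      exact ⟨h1, h4, h3, by rwa [h5]⟩
  have hDn : ∀ v ∈ Z, q v ≠ q s → (D (q v)).1 ∈ q v ∧ (D (q v)).2 ∈ Z ∧
      0 < a (D (q v)).1 (D (q v)).2 ∧ q (D (q v)).2 = d (q v) ∧ D (q v) ≠ (y₀, s₀) := by
    intro v hv hvs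
    have e1 := hb.down_mem _ (hmem v hv) hvs
    obtain ⟨h1, h2, h3, hn⟩ := hl _ _ (hb.down_adj _ (hmem v hv) hvs)
    obtain ⟨h4, h5⟩ := hq.eq_of_mem e1 h2
    exact ⟨h1, h4, h3, h5, hn⟩
  have hDlt : ∀ v ∈ Z, q v ≠ q s → r (q (D (q v)).2) < r (q v) := fun v hv hvs => by
    rw [(hDn v hv hvs).2.2.2.1]
    exact hb.down_lt _ (hmem v hv) hvs
  refine hasSTBranching_of_blocks q r U D (fun v hv w hw e => hb.inj (hmem v hv) (hmem w hw) e)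
    (fun v hv hvt => ?_) (fun v hv hvs => ?_) (fun v hv w hw hvt hws => ?_) (fun v hv => ?_)
  · obtain ⟨h1, h2⟩ := hUp v hv hvt
    exact ⟨(hq v hv).2.2.2 _ h1, h2⟩
  · obtain ⟨h1, h2, h3, -, -⟩ := hDn v hv hvs
    exact ⟨(hq v hv).2.2.2 _ h1, h2, h3, hDlt v hv hvs⟩
  · obtain ⟨h1, h2, h3, h4, h5⟩ := hDn w hw hws
    intro e
    by_cases h : q v = q s
    · refine h5 ?_
      rw [e, h]
      simp only [hU, if_true, Prod.swap_prod_mk]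
    · have e1 := hb.up_mem _ (hmem v hv) ⟨h, hvt⟩
      have k := hl _ _ (hb.up_adj _ (hmem v hv) ⟨h, hvt⟩)
      have eU : U (q v) = lift (q v) (u (q v)) := by simp only [hU, if_neg h]
      have f1 : u (q v) = q w := by
        rw [← (hq.eq_of_mem e1 k.2.1).2, ← eU, ← Prod.fst_swap, ← e]
        exact (hq w hw).2.2.2 _ h1
      have f2 : d (q w) = q v := by
        rw [← h4, e, Prod.snd_swap]
        exact (hq v hv).2.2.2 _ (hUp v hv hvt).1
      exact hb.distinct _ (hmem v hv) ⟨h, hvt⟩ (by rwa [f1]) (by rw [f1, f2])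
  · have hfil : (Z.filter fun w => q w = q v) = q v := by
      ext w
      simp only [Finset.mem_filter]
      refine ⟨fun h => h.2 ▸ (hq w h.1).1, fun h => ⟨(hq v hv).2.1 h, (hq v hv).2.2.2 w h⟩⟩
    rw [hfil]
    have hbot : (if q v = q s then s else (D (q v)).1) ∈ q v := by
      split_ifs with h
      · rw [h]
        exact (hq s hs).1
      · exact (hDn v hv h).1
    have htop : (if q v = q t then t else (U (q v)).1) ∈ q v := by
      split_ifs with h
      · rw [h]
        exact (hq t ht).1
      · exact (hUp v hv h).1
    rcases Nat.lt_or_ge (q v).card 2 with h1 | h2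
    · have hone := Finset.card_le_one.1 (Nat.le_of_lt_succ h1)
      have : q v = {v} := Finset.eq_singleton_iff_unique_mem.2
        ⟨(hq v hv).1, fun x hx => hone x hx v (hq v hv).1⟩
      rw [hone _ hbot v (hq v hv).1, hone _ htop v (hq v hv).1]
      conv => arg 2; rw [this]
      exact hasSTBranching_singleton v
    · have htight := (hq v hv).2.2.1
      have hsub := (hq v hv).2.1
      have hout : ∀ x ∈ q v, ∀ y ∈ Z, r (q y) ≠ r (q v) → 0 < a x y →
          weightSum a {x} (q v) ≤ 3 ∧ x ≠ s ∧ x ≠ t := by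
        intro x hx y hy hyv hxy
        have e1 := weightSum_sdiff_right (a := a) hsub {x}
        have e2 := ha.degree_le x Z
        have e3 := one_le_weightSum_singleton (a := a) (x := x) (y := y) (Y := Z \ q v)
          (by simp only [Finset.mem_sdiff, hy, true_and]
              exact fun h => hyv (by rw [(hq v hv).2.2.2 y h])) hxy
        have e4 := ha.three_le_degree htight h2 hx
        refine ⟨by omega, ?_, ?_⟩ <;> rintro rfl <;> omega
      have hmono : ∀ x, weightSum a {x} (q v) ≤ weightSum a {x} Z := fun x =>
        weightSum_mono (Finset.Subset.refl _) hsub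
      refine ih (q v) ⟨hsub, fun h => hst ?_⟩ htight _ hbot _ htop ?_ ?_ ?_
      · rw [(hq v hv).2.2.2 s (h hs), (hq v hv).2.2.2 t (h ht)]
      · split_ifs with g1 g2 g2
        · exact absurd (g1.symm.trans g2) hst
        · obtain ⟨k1, k2, k3, k4⟩ := hUp v hv g2
          exact (hout _ k1 _ k2 k4.ne' k3).2.1.symm
        · obtain ⟨k1, k2, k3, -, -⟩ := hDn v hv g1
          exact (hout _ k1 _ k2 (hDlt v hv g1).ne k3).2.2
        · obtain ⟨k1, k2, k3, k4⟩ := hUp v hv g2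
          obtain ⟨j1, j2, j3, -, -⟩ := hDn v hv g1
          have j4 := hDlt v hv g1
          intro e
          rw [e] at j3
          have e1 := ha.out_degree_le_one htight h2 Finset.disjoint_sdiff k1 (Y := Z \ q v)
          have e2 := two_le_weightSum_singleton (a := a) (x := (U (q v)).1)
            (y := (U (q v)).2) (y' := (D (q v)).2) (Y := Z \ q v)
            (by simp only [Finset.mem_sdiff, k2, true_and]
                exact fun h => k4.ne' (by rw [(hq v hv).2.2.2 _ h]))
            (by simp only [Finset.mem_sdiff, j2, true_and]
                exact fun h => j4.ne (by rw [(hq v hv).2.2.2 _ h]))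
            (fun h => by rw [h] at k4; omega) k3 j3
          omega
      · split_ifs with h
        · exact (hmono s).trans hs3
        · obtain ⟨k1, k2, k3, -, -⟩ := hDn v hv h
          exact (hout _ k1 _ k2 (hDlt v hv h).ne k3).1
      · split_ifs with h
        · exact (hmono t).trans ht3
        · obtain ⟨k1, k2, k3, k4⟩ := hUp v hv h
          exact (hout _ k1 _ k2 k4.ne' k3).1

/-- The maximal proper tight subsets form a partition, if there is no partition into two
tight sets. -/
lemma exists_maximal_tight (ha : IsNormalSparse a) {Z : Finset α} (hZ2 : 2 ≤ Z.card)
    (hno : ∀ X ⊂ Z, X.Nonempty → IsTight a X → ¬ IsTight a (Z \ X)) {v : α} (hv : v ∈ Z) :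
    ∃ M ⊂ Z, v ∈ M ∧ IsTight a M ∧ ∀ X ⊂ Z, v ∈ X → IsTight a X → X ⊆ M := by
  classical
  have hsing : {v} ∈ Z.powerset.filter (fun X => X ⊂ Z ∧ v ∈ X ∧ IsTight a X) := by
    have hss : {v} ⊂ Z := by
      refine Finset.ssubset_iff_subset_ne.2 ⟨by simpa using hv, ?_⟩
      rintro rfl
      simp at hZ2
    simp only [Finset.mem_filter, Finset.mem_powerset]
    exact ⟨hss.1, hss, by simp, by simp [IsTight, weightSum, ha.irrefl]⟩
  obtain ⟨M, hM, hmax⟩ := Finset.exists_max_image _ Finset.card ⟨_, hsing⟩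
  simp only [Finset.mem_filter, Finset.mem_powerset] at hM hmax
  obtain ⟨-, hMZ, hvM, hMt⟩ := hM
  refine ⟨M, hMZ, hvM, hMt, fun X hX hvX hXt => ?_⟩
  have hinter : (X ∩ M).Nonempty := ⟨v, Finset.mem_inter.2 ⟨hvX, hvM⟩⟩
  have hun : X ∪ M ≠ Z := by
    intro e
    have h1 : Z \ X = M \ X := by rw [← e, Finset.union_sdiff_left]
    have h2 : X \ M = Z \ M := by rw [← e, Finset.union_sdiff_right]
    refine hno X hX ⟨v, hvX⟩ hXt ?_
    rw [h1]
    refine ha.isTight_sdiff_of_crossing hXt hMt hinter ?_ ?_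
    · rw [h2]
      exact Finset.sdiff_nonempty.2 hMZ.2
    · rw [← h1]
      exact Finset.sdiff_nonempty.2 hX.2
  have hsub : X ∪ M ⊆ Z := Finset.union_subset hX.1 hMZ.1
  have hle := hmax (X ∪ M) ⟨hsub, Finset.ssubset_iff_subset_ne.2 ⟨hsub, hun⟩,
    Finset.mem_union_right _ hvM, (ha.isTight_union hXt hMt hinter).1⟩
  rw [Finset.eq_of_subset_of_card_le Finset.subset_union_right hle]
  exact Finset.subset_union_left

lemma hasSTBranching_of_tight_sdiff (ha : IsNormalSparse a) {Z X : Finset α} {s t : α}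
    (hZ : IsTight a Z) (hZ2 : 2 ≤ Z.card) (hXZ : X ⊂ Z)
    (hX : IsTight a X) (hY : IsTight a (Z \ X)) (hsX : s ∈ X) (ht : t ∈ Z) (hst : s ≠ t)
    (hs3 : weightSum a {s} Z ≤ 3) (ht3 : weightSum a {t} Z ≤ 3)
    (ih : ∀ Y ⊂ Z, IsTight a Y → ∀ x ∈ Y, ∀ y ∈ Y, x ≠ y → weightSum a {x} Y ≤ 3 →
      weightSum a {y} Y ≤ 3 → HasSTBranching a Y x y) :
    HasSTBranching a Z s t := by
  have hYne : (Z \ X).Nonempty := Finset.sdiff_nonempty.2 hXZ.2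
  have hYZ : Z \ X ⊂ Z := Finset.sdiff_ssubset hXZ.1 ⟨s, hsX⟩
  have hs := hXZ.1 hsX
  by_cases htX : t ∈ X
  · have hcard : ∀ W ⊆ Z, W.Nonempty → IsTight a (Z \ W) → 2 ≤ W.card := by
      intro W hWZ hW hWt
      by_contra hlt
      have := Finset.card_pos.2 hW
      obtain ⟨x, rfl⟩ := Finset.card_eq_one.1 (show W.card = 1 by omega)
      rw [← Finset.erase_eq] at hWt
      exact ha.not_tight_erase Z x (hWZ (by simp)) hZ2 hZ hWt
    have hX2 := hcard X hXZ.1 ⟨s, hsX⟩ hY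
    have hY2 := hcard (Z \ X) Finset.sdiff_subset hYne
      (by rwa [Finset.sdiff_sdiff_eq_self hXZ.1])
    have e1 := weightSum_sdiff_self ha.symm hXZ.1
    have e2 := Finset.card_sdiff_add_card_eq_card hXZ.1
    have e3 : 2 ≤ weightSum a X (Z \ X) := by
      unfold IsTight at hX hY hZ
      omega
    have hmono : ∀ x, weightSum a {x} X ≤ weightSum a {x} Z := fun x =>
      weightSum_mono (Finset.Subset.refl _) hXZ.1
    have := ha.hasSTBranching_union hX hY hX2 hY2 Finset.disjoint_sdiff e3 hsX htX
      (ih X hXZ hX s hsX t htX hst ((hmono s).trans hs3) ((hmono t).trans ht3))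
      (fun y hy y' hy' => ih (Z \ X) hYZ hY y hy y' hy')
    rwa [Finset.union_sdiff_of_subset hXZ.1] at this
  · have hq : IsTightPartition a Z (fun v => if v ∈ X then X else Z \ X) := by
      intro v hv
      by_cases h : v ∈ X
      · simp only [h, if_true, true_and]
        exact ⟨hXZ.1, hX, fun w hw => if_pos hw⟩
      · simp only [h, if_false, Finset.mem_sdiff, hv, not_false_eq_true, and_self, true_and]
        exact ⟨Finset.sdiff_subset, hY, fun w hw => if_neg hw.2⟩
    refine ha.hasSTBranching_of_tightPartition hZ hq (fun S hS hS2 hne => absurd ?_ hne)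
      hs ht ?_ hs3 ht3 ih
    · have himg : Z.image (fun v => if v ∈ X then X else Z \ X) ⊆ {X, Z \ X} := by
        intro p hp
        obtain ⟨v, -, rfl⟩ := Finset.mem_image.1 hp
        by_cases h : v ∈ X <;> simp [h]
      exact Finset.eq_of_subset_of_card_le hS
        ((Finset.card_le_card himg).trans (Finset.card_le_two.trans hS2))
    · simp only [hsX, htX, if_true, if_false]
      intro e
      rw [e] at hsX
      exact (Finset.mem_sdiff.1 hsX).2 (e ▸ hsX)

/-- A tight set has an ordering between any two of its vertices of degree at most 3. -/
theorem hasSTBranching (ha : IsNormalSparse a) {Z : Finset α} (hZ : IsTight a Z) {s t : α}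
    (hs : s ∈ Z) (ht : t ∈ Z) (hst : s ≠ t) (hs3 : weightSum a {s} Z ≤ 3)
    (ht3 : weightSum a {t} Z ≤ 3) : HasSTBranching a Z s t := by
  induction Z using Finset.strongInduction generalizing s t with
  | H Z ih =>
  have ih' : ∀ Y ⊂ Z, IsTight a Y → ∀ x ∈ Y, ∀ y ∈ Y, x ≠ y → weightSum a {x} Y ≤ 3 →
      weightSum a {y} Y ≤ 3 → HasSTBranching a Y x y :=
    fun Y hY hYt x hx y hy => ih Y hY hYt hx hy
  have hZ2 : 2 ≤ Z.card := Finset.one_lt_card.2 ⟨s, hs, t, ht, hst⟩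
  by_cases hno : ∀ X ⊂ Z, X.Nonempty → IsTight a X → ¬ IsTight a (Z \ X)
  · have hmax : ∀ v, ∃ M, v ∈ Z → M ⊂ Z ∧ v ∈ M ∧ IsTight a M ∧
        ∀ X ⊂ Z, v ∈ X → IsTight a X → X ⊆ M := by
      intro v
      by_cases hv : v ∈ Z
      · obtain ⟨M, hM⟩ := ha.exists_maximal_tight hZ2 hno hv
        exact ⟨M, fun _ => hM⟩
      · exact ⟨∅, fun h => absurd h hv⟩
    choose q hq using hmax
    have hpart : IsTightPartition a Z q := by
      intro v hv
      obtain ⟨h1, h2, h3, h4⟩ := hq v hv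
      refine ⟨h2, h1.1, h3, fun w hw => ?_⟩
      obtain ⟨k1, k2, k3, k4⟩ := hq w (h1.1 hw)
      have hsub := k4 _ h1 hw h3
      exact (h4 _ k1 (hsub h2) k3).antisymm hsub
    refine ha.hasSTBranching_of_tightPartition hZ hpart (fun S hS hS2 hne hSt => ?_)
      hs ht (fun e => ?_) hs3 ht3 ih'
    · obtain ⟨p₀, hp₀, hp₀S⟩ := Finset.exists_of_ssubset (Finset.ssubset_iff_subset_ne.2 ⟨hS, hne⟩)
      obtain ⟨v₀, hv₀, rfl⟩ := Finset.mem_image.1 hp₀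
      obtain ⟨p, hp, p', hp', hpp⟩ := Finset.one_lt_card.1 hS2
      obtain ⟨v, hv, rfl⟩ := Finset.mem_image.1 (hS hp)
      obtain ⟨w, hw, rfl⟩ := Finset.mem_image.1 (hS hp')
      have hsub : S.biUnion id ⊂ Z := by
        refine Finset.ssubset_iff_subset_ne.2 ⟨?_, fun e => ?_⟩
        · rw [← hpart.biUnion_eq]
          exact Finset.biUnion_subset_biUnion_of_subset_left _ hS
        · rw [← e] at hv₀
          obtain ⟨p, hpS, hvp⟩ := Finset.mem_biUnion.1 hv₀
          rw [(hpart.eq_of_mem (hS hpS) hvp).2] at hp₀S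
          exact hp₀S hpS
      have h1 := (hq v hv).2.2.2 _ hsub (Finset.mem_biUnion.2 ⟨_, hp, (hq v hv).2.1⟩) hSt
      exact hpp ((hpart v hv).2.2.2 w
        (h1 (Finset.mem_biUnion.2 ⟨_, hp', (hq w hw).2.1⟩))).symm
    · obtain ⟨h1, h2, h3, -⟩ := hq s hs
      exact hno _ h1 ⟨s, h2⟩ h3
        (ha.isTight_sdiff_of_mem hZ h3 h1 hst h2 (e ▸ (hq t ht).2.1) hs3 ht3)
  · push Not at hno
    obtain ⟨X, hXZ, hXne, hX, hY⟩ := hno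
    by_cases hsX : s ∈ X
    · exact ha.hasSTBranching_of_tight_sdiff hZ hZ2 hXZ hX hY hsX ht hst hs3 ht3 ih'
    · exact ha.hasSTBranching_of_tight_sdiff hZ hZ2 (Finset.sdiff_ssubset hXZ.1 hXne) hY
        (by rwa [Finset.sdiff_sdiff_eq_self hXZ.1]) (Finset.mem_sdiff.2 ⟨hs, hsX⟩) ht hst hs3 ht3
        ih'

end IsNormalSparse

section Graph

variable {α : Type*}

/-- The adjacency weight function of a graph. -/
def adjWeight (G : SimpleGraph α) [DecidableRel G.Adj] (x y : α) : ℕ :=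
  if G.Adj x y then 1 else 0

variable {G : SimpleGraph α} [DecidableRel G.Adj]

lemma adjWeight_pos {x y : α} : 0 < adjWeight G x y ↔ G.Adj x y := by
  unfold adjWeight
  split_ifs with h <;> simp [h]

lemma adjWeight_le_one (x y : α) : adjWeight G x y ≤ 1 := by
  unfold adjWeight
  split_ifs <;> simp

lemma adjWeight_symm (x y : α) : adjWeight G x y = adjWeight G y x := by
  simp [adjWeight, G.adj_comm]

lemma adjWeight_self (x : α) : adjWeight G x x = 0 := by
  simp [adjWeight]

lemma weightSum_adjWeight_univ [Fintype α] (x : α) :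
    weightSum (adjWeight G) {x} Finset.univ = gdeg G x := by
  rw [gdeg, Set.ncard_eq_toFinset_card']
  simp [weightSum, adjWeight]

lemma card_support_weightSum_le (X Y : Finset α) (a : α → α → ℕ) :
    {x ∈ X | 0 < weightSum a {x} Y}.card ≤ weightSum a X Y := by
  rw [weightSum_eq_sum_singleton, Finset.card_filter]
  refine Finset.sum_le_sum fun x _ => ?_
  split_ifs <;> omega

variable [DecidableEq α]

lemma weightSum_adjWeight_singleton_lt {x : α} {X : Finset α} (hx : x ∈ X) :
    weightSum (adjWeight G) {x} X + 1 ≤ X.card := by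
  rw [weightSum_singleton_left, ← Finset.sum_erase X (adjWeight_self x),
    ← Finset.card_erase_add_one hx]
  have := Finset.sum_le_card_nsmul (X.erase x) _ 1 fun y _ => adjWeight_le_one (G := G) x y
  simpa using this

lemma weightSum_adjWeight_self_le (X : Finset α) :
    weightSum (adjWeight G) X X + X.card ≤ X.card * X.card := by
  have h : weightSum (adjWeight G) X X + X.card =
      ∑ x ∈ X, (weightSum (adjWeight G) {x} X + 1) := by
    rw [Finset.sum_add_distrib, ← weightSum_eq_sum_singleton]
    simp
  rw [h]
  simpa using Finset.sum_le_card_nsmul X _ _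
    fun x hx => weightSum_adjWeight_singleton_lt (G := G) hx

variable [Fintype α]

lemma weightSum_adjWeight_add_compl (hreg : ∀ v, gdeg G v = 4) (X : Finset α) :
    weightSum (adjWeight G) X X + weightSum (adjWeight G) X Xᶜ = 4 * X.card := by
  rw [← weightSum_union_right disjoint_compl_right, Finset.union_compl,
    weightSum_eq_sum_singleton]
  simp [weightSum_adjWeight_univ, hreg, mul_comm]

/-- In a 4-connected graph, if at most 3 vertices of a proper subset `X` have a neighbor outside
`X`, then all vertices of `X` do. -/
lemma boundary_eq (hconn : ∀ S : Set α, S.ncard < 4 → (G.induce Sᶜ).Connected)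
    {X : Finset α} (hX : X ≠ Finset.univ)
    (hS : {x ∈ X | 0 < weightSum (adjWeight G) {x} Xᶜ}.card ≤ 3) :
    {x ∈ X | 0 < weightSum (adjWeight G) {x} Xᶜ} = X := by
  set S := {x ∈ X | 0 < weightSum (adjWeight G) {x} Xᶜ} with hSdef
  by_contra hne
  obtain ⟨x, hx, hxS⟩ := Finset.exists_of_ssubset
    (Finset.ssubset_iff_subset_ne.2 ⟨Finset.filter_subset _ X, hne⟩)
  obtain ⟨y, hy⟩ : ∃ y, y ∉ X := by
    by_contra! h
    exact hX (Finset.eq_univ_iff_forall.2 h)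
  have hc := hconn (S : Set α) (by rw [Set.ncard_coe_finset]; omega)
  have hyS : y ∉ S := fun h => hy (Finset.mem_filter.1 h).1
  obtain ⟨w⟩ := hc.preconnected ⟨x, fun h => hxS (Finset.mem_coe.1 h)⟩
    ⟨y, fun h => hyS (Finset.mem_coe.1 h)⟩
  obtain ⟨e, he, h1, h2⟩ := w.exists_boundary_dart {v | (v : α) ∈ X} hx hy
  refine e.fst.2 (Finset.mem_coe.2 (Finset.mem_filter.2 ⟨h1, ?_⟩))
  have hadj : G.Adj e.fst e.snd := e.adj
  exact one_le_weightSum_singleton (Finset.mem_compl.2 h2) (adjWeight_pos.2 hadj)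

lemma weightSum_adjWeight_sparse (hreg : ∀ v, gdeg G v = 4)
    (hconn : ∀ S : Set α, S.ncard < 4 → (G.induce Sᶜ).Connected)
    {X : Finset α} (hne : X.Nonempty) (hX : X ≠ Finset.univ) :
    weightSum (adjWeight G) X X + 4 ≤ 4 * X.card := by
  have h1 := weightSum_adjWeight_add_compl hreg X
  by_contra! h
  have h2 := card_support_weightSum_le X Xᶜ (adjWeight G)
  have h3 := boundary_eq hconn hX (by omega)
  rw [h3] at h2
  have h4 := weightSum_adjWeight_self_le (G := G) X
  have h5 := hne.card_pos
  have h6 : X.card ≤ 3 := by omega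
  generalize X.card = n at *
  interval_cases n <;> omega

lemma not_isTight_of_degree_two (hreg : ∀ v, gdeg G v = 4)
    (hconn : ∀ S : Set α, S.ncard < 4 → (G.induce Sᶜ).Connected)
    {X : Finset α} (h2 : 2 ≤ X.card) (hX : X ≠ Finset.univ) {x : α} (hx : x ∈ X)
    (hxX : weightSum (adjWeight G) {x} X = 2) : ¬ IsTight (adjWeight G) X := by
  intro ht
  unfold IsTight at ht
  have h1 := weightSum_adjWeight_add_compl hreg X
  have h4 : weightSum (adjWeight G) {x} X + weightSum (adjWeight G) {x} Xᶜ = 4 := by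
    rw [← weightSum_union_right disjoint_compl_right, Finset.union_compl,
      weightSum_adjWeight_univ, hreg]
  have h5 : weightSum (adjWeight G) X Xᶜ =
      weightSum (adjWeight G) {x} Xᶜ + weightSum (adjWeight G) (X.erase x) Xᶜ := by
    rw [← weightSum_union_left (by simp), ← Finset.insert_eq, Finset.insert_erase hx]
  have h6 := card_support_weightSum_le (X.erase x) Xᶜ (adjWeight G)
  rw [Finset.filter_erase] at h6
  have h7 := Finset.pred_card_le_card_erase (s := {x ∈ X | 0 < weightSum (adjWeight G) {x} Xᶜ})
    (a := x)
  have h8 := boundary_eq hconn hX (by omega)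
  rw [h8] at h6 h7
  have h9 := weightSum_adjWeight_self_le (G := G) X
  have h10 : X.card ≤ 3 := by omega
  generalize X.card = n at *
  interval_cases n <;> omega

/-- Deleting two disjoint edges from a 4-regular 4-connected graph gives a normal sparse graph
which is tight. -/
lemma isNormalSparse_of_delete (hreg : ∀ v, gdeg G v = 4)
    (hconn : ∀ S : Set α, S.ncard < 4 → (G.induce Sᶜ).Connected)
    {a : α → α → ℕ} {s p t q : α} (hsp : s ≠ p) (htq : t ≠ q) (hst : s ≠ t) (hpt : p ≠ t)
    (hqs : q ≠ s) (hpq : p ≠ q)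
    (hg : adjWeight G = fun x y => a x y + (pairWeight s p x y + pairWeight t q x y)) :
    IsNormalSparse a ∧ IsTight a Finset.univ ∧
      weightSum a {s} Finset.univ = 3 ∧ weightSum a {t} Finset.univ = 3 := by
  have hg' : ∀ x y, adjWeight G x y = a x y + (pairWeight s p x y + pairWeight t q x y) :=
    fun x y => congrFun (congrFun hg x) y
  have hself (X : Finset α) : weightSum (adjWeight G) X X = weightSum a X X +
      ((if s ∈ X ∧ p ∈ X then 2 else 0) + (if t ∈ X ∧ q ∈ X then 2 else 0)) := by
    rw [hg, weightSum_add, weightSum_add, weightSum_pairWeight hsp, weightSum_pairWeight htq]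
  have hdeg (x : α) (X : Finset α) := congrArg (fun b => weightSum b {x} X) hg
  simp only [weightSum_add, weightSum_pairWeight_singleton hsp,
    weightSum_pairWeight_singleton htq] at hdeg
  have huniv (x : α) := hdeg x Finset.univ
  simp only [weightSum_adjWeight_univ, hreg, Finset.mem_univ, and_true] at huniv
  have hsymm : ∀ x y, a x y = a y x := fun x y => by
    have h1 := hg' x y
    have h2 := hg' y x
    rw [adjWeight_symm, pairWeight_symm s p, pairWeight_symm t q] at h1
    omega
  have hirrefl : ∀ x, a x x = 0 := fun x => by
    have h1 := hg' x x
    rw [adjWeight_self] at h1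
    omega
  have htight : IsTight a Finset.univ := by
    have h1 := weightSum_adjWeight_add_compl hreg Finset.univ
    have h2 := hself Finset.univ
    rw [Finset.compl_univ] at h1
    simp only [Finset.mem_univ, and_self, if_true] at h2
    unfold IsTight
    have h3 : weightSum (adjWeight G) Finset.univ ∅ = 0 := by simp [weightSum]
    omega
  refine ⟨⟨hsymm, hirrefl, fun x y => ?_, fun x X => ?_, fun X hX => ?_, fun X x hx h2 hX => ?_⟩,
    htight, ?_, ?_⟩
  · have h1 := hg' x y
    have := adjWeight_le_one (G := G) x y
    omega
  · have h1 := weightSum_mono (a := a) (Finset.Subset.refl {x}) (Finset.subset_univ X)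
    have := huniv x
    omega
  · by_cases h : X = Finset.univ
    · rw [h]
      exact htight.le
    · have := weightSum_adjWeight_sparse hreg hconn hX h
      have := hself X
      omega
  · intro hX'
    have e1 := weightSum_erase_self hsymm hirrefl hx
    have e2 := Finset.card_erase_add_one hx
    unfold IsTight at hX hX'
    by_cases h : X = Finset.univ
    · subst h
      have := huniv x
      split_ifs at this <;> first | omega | (subst_vars; simp_all)
    · have hne : (X.erase x).Nonempty := Finset.card_pos.1 (by omega)
      have h' : X.erase x ≠ Finset.univ := fun e => by
        have := Finset.mem_univ x
        rw [← e] at this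
        simp at this
      have h1 := weightSum_adjWeight_sparse hreg hconn ⟨x, hx⟩ h
      have h3 := weightSum_adjWeight_sparse hreg hconn hne h'
      have h4 := hself X
      have h5 := hself (X.erase x)
      have h6 := weightSum_erase_self (a := adjWeight G) adjWeight_symm adjWeight_self hx
      refine not_isTight_of_degree_two hreg hconn h2 h hx ?_ ?_
      · omega
      · unfold IsTight
        omega
  · have := huniv s
    simp [hsp, hst, hqs.symm] at this
    omega
  · have := huniv t
    simp [htq, hst.symm, hpt.symm] at this
    omega

end Graph

section Trees

variable {α : Type*}

/-- The graph joining every vertex other than `t` to its image under `f`. -/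
def functionGraph (f : α → α) (t : α) : SimpleGraph α :=
  SimpleGraph.fromRel fun v w => v ≠ t ∧ w = f v

lemma functionGraph_adj_self {f : α → α} {t v : α} (hv : v ≠ t) (hf : f v ≠ v) :
    (functionGraph f t).Adj v (f v) := by
  simp [functionGraph, hv, hf.symm]

lemma functionGraph_le {f : α → α} {t : α} {G : SimpleGraph α}
    (h : ∀ v, v ≠ t → G.Adj v (f v)) : functionGraph f t ≤ G := by
  rintro v w ⟨-, ⟨hv, rfl⟩ | ⟨hw, rfl⟩⟩
  · exact h v hv
  · exact (h w hw).symm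

/-- If the parent function `f` decreases a rank at all vertices other than the root, its graph
is a tree. -/
lemma functionGraph_isTree [Finite α] {f : α → α} {t : α} {r : α → ℕ}
    (hr : ∀ v, v ≠ t → r (f v) < r v) : (functionGraph f t).IsTree := by
  classical
  have hreach : ∀ v, (functionGraph f t).Reachable v t := by
    intro v
    induction hn : r v using Nat.strong_induction_on generalizing v with
    | _ n ih =>
      subst hn
      by_cases hv : v = t
      · rw [hv]
      · have hlt := hr v hv
        have hne : f v ≠ v := fun e => by rw [e] at hlt; exact hlt.false
        exact (functionGraph_adj_self hv hne).reachable.trans (ih _ hlt (f v) rfl)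
  have hconn : (functionGraph f t).Connected :=
    { preconnected := fun v w => (hreach v).trans (hreach w).symm
      nonempty := ⟨t⟩ }
  rw [SimpleGraph.isTree_iff_connected_and_card]
  refine ⟨hconn, le_antisymm ?_ hconn.card_vert_le_card_edgeSet_add_one⟩
  have hsub : (functionGraph f t).edgeSet ⊆ (fun v => s(v, f v)) '' {t}ᶜ := by
    intro e
    induction e with
    | _ v w =>
      rintro ⟨-, ⟨hv, hw⟩ | ⟨hw, hv⟩⟩
      · exact ⟨v, hv, congrArg (fun x => s(v, x)) hw.symm⟩
      · exact ⟨w, hw, Sym2.eq_swap.trans (congrArg (fun x => s(x, w)) hv.symm)⟩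
  have h1 := Set.ncard_le_ncard hsub
  have h2 := Set.ncard_image_le (f := fun v => s(v, f v)) (s := ({t}ᶜ : Set α))
  have h3 := Set.ncard_add_ncard_compl ({t} : Set α)
  rw [Set.ncard_singleton] at h3
  have h4 := Nat.card_coe_set_eq (functionGraph f t).edgeSet
  omega

/-- A branching of all vertices of a graph yields an `(s,t)`-triple. -/
lemma HasSTBranching.hasSTTriple [Fintype α] {G : SimpleGraph α} {a : α → α → ℕ} {s t : α}
    (h : HasSTBranching a Finset.univ s t) (hG : ∀ x y, 0 < a x y → G.Adj x y) :
    HasSTTriple G s t := by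
  obtain ⟨r, u, d, h⟩ := h
  have hinj : Function.Injective r := by
    have := h.inj
    rwa [Finset.coe_univ, Set.injOn_univ] at this
  have hu (v : α) (hv : v ≠ t) := h.up_lt v (Finset.mem_univ v) hv
  have hd (v : α) (hv : v ≠ s) := h.down_lt v (Finset.mem_univ v) hv
  have hI (v : α) (hv : v ≠ t) := hG _ _ (h.up_adj v (Finset.mem_univ v) hv)
  have hO (v : α) (hv : v ≠ s) := hG _ _ (h.down_adj v (Finset.mem_univ v) hv)
  obtain ⟨N, hN⟩ : ∃ N, ∀ v, r v ≤ N :=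
    ⟨∑ v, r v, fun v => Finset.single_le_sum (fun _ _ => Nat.zero_le _) (Finset.mem_univ v)⟩
  have hItree : (functionGraph u t).IsTree := functionGraph_isTree (r := fun v => N - r v)
    fun v hv => by
      have := hu v hv
      have := hN (u v)
      omega
  have hOtree : (functionGraph d s).IsTree := functionGraph_isTree hd
  refine ⟨LinearOrder.lift' r hinj, functionGraph u t, functionGraph d s,
    ⟨functionGraph_le hI, hItree.connected, hItree.isAcyclic⟩,
    ⟨functionGraph_le hO, hOtree.connected, hOtree.isAcyclic⟩, ?_,
    fun v hv => ⟨u v, functionGraph_adj_self hv (hI v hv).ne', hu v hv⟩,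
    fun v hv => ⟨d v, functionGraph_adj_self hv (hO v hv).ne', hd v hv⟩⟩
  have key : ∀ v, v ≠ t → u v ≠ s → d (u v) ≠ v := fun v hv => h.distinct v (Finset.mem_univ v) hv
  refine SimpleGraph.ext (funext fun v => funext fun w => propext ⟨?_, False.elim⟩)
  rintro ⟨⟨-, ⟨hv, rfl⟩ | ⟨hw, rfl⟩⟩, ⟨-, ⟨hv', e⟩ | ⟨hw', e⟩⟩⟩
  · have h1 := hu v hv
    have h2 := hd v hv'
    rw [← e] at h2
    exact h1.asymm h2
  · exact key v hv hw' e.symm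
  · exact key w hw hv' e.symm
  · have h1 := hu w hw
    have h2 := hd w hw'
    rw [← e] at h2
    exact h1.asymm h2

end Trees

lemma exists_adj_ne_ne {α : Type*} [Fintype α] {G : SimpleGraph α} {v : α} (hv : gdeg G v = 4)
    (x y : α) : ∃ w, G.Adj v w ∧ w ≠ x ∧ w ≠ y := by
  have h1 : ({x, y} : Set α).ncard < (G.neighborSet v).ncard := by
    have := Set.ncard_insert_le x {y}
    rw [Set.ncard_singleton] at this
    unfold gdeg at hv
    omega
  obtain ⟨w, hw, hw'⟩ := Set.exists_mem_notMem_of_ncard_lt_ncard h1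
  simp only [Set.mem_insert_iff, Set.mem_singleton_iff, not_or] at hw'
  exact ⟨w, hw, hw'⟩

/-- Every 4-regular 4-connected graph admits an `(s,t)`-triple for every pair of
distinct vertices `s ≠ t`. -/
theorem stmt0 [Fintype V] (G : SimpleGraph V)
    (hreg : ∀ v : V, gdeg G v = 4)
    (hcard : 4 < Fintype.card V)
    (hconn : ∀ S : Set V, S.ncard < 4 → (G.induce Sᶜ).Connected)
    (s t : V) (hst : s ≠ t) :
    HasSTTriple G s t := by
  classical
  obtain ⟨p, hsp, hpt, -⟩ := exists_adj_ne_ne (hreg s) t t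
  obtain ⟨q, htq, hqs, hqp⟩ := exists_adj_ne_ne (hreg t) s p
  let a : V → V → ℕ := fun x y => adjWeight G x y - (pairWeight s p x y + pairWeight t q x y)
  have hg : adjWeight G = fun x y => a x y + (pairWeight s p x y + pairWeight t q x y) := by
    funext x y
    refine (Nat.sub_add_cancel ?_).symm
    have h1 := hsp.symm
    have h2 := htq.symm
    unfold pairWeight adjWeight
    grind
  obtain ⟨ha, htight, hs, ht⟩ :=
    isNormalSparse_of_delete hreg hconn hsp.ne htq.ne hst hpt hqs hqp.symm hg
  refine (ha.hasSTBranching htight (Finset.mem_univ s) (Finset.mem_univ t) hst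
    hs.le ht.le).hasSTTriple fun x y hxy => ?_
  exact adjWeight_pos.1 (hxy.trans_le (Nat.sub_le _ _))
end

section
/- Let n ≥ 8 and let G be a simple graph on n vertices with minimum degree at least ⌊n/2⌋. Then G has property (*), unless n is odd and G is the graph obtained by identifying two disjoint copies of the complete graph K_{⌈n/2⌉} at a single vertex. -/
open SimpleGraph

universe u

variable {V : Type u}

/-- Witness for an `(s,t)`-triple on the vertex set `S`: a ranking `f` such that `up` maps every
vertex of `S` except `t` to a higher neighbor, `dn` maps every vertex of `S` except `s` to a lower
neighbor, and no edge is used in both directions. -/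
structure IsRanking (G : SimpleGraph V) (S : Finset V) (s t : V) (f : V → ℝ) (up dn : V → V) :
    Prop where
  up_mem : ∀ v ∈ S, v ≠ t → up v ∈ S
  up_adj : ∀ v ∈ S, v ≠ t → G.Adj v (up v)
  up_lt : ∀ v ∈ S, v ≠ t → f v < f (up v)
  dn_mem : ∀ v ∈ S, v ≠ s → dn v ∈ S
  dn_adj : ∀ v ∈ S, v ≠ s → G.Adj v (dn v)
  dn_lt : ∀ v ∈ S, v ≠ s → f (dn v) < f v
  ne : ∀ v ∈ S, v ≠ t → up v ≠ s → dn (up v) ≠ v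

/-- The induced subgraph on `S` has a witness for an `(s,t)`-triple. -/
def Rankable (G : SimpleGraph V) (S : Finset V) (s t : V) : Prop :=
  ∃ (f : V → ℝ) (up dn : V → V), IsRanking G S s t f up dn

theorem IsRanking.symm {G : SimpleGraph V} {S : Finset V} {s t : V} {f : V → ℝ} {up dn : V → V}
    (h : IsRanking G S s t f up dn) : IsRanking G S t s (fun v => -f v) dn up where
  up_mem := h.dn_mem
  up_adj := h.dn_adj
  up_lt v hv hs := neg_lt_neg (h.dn_lt v hv hs)
  dn_mem := h.up_mem
  dn_adj := h.up_adj
  dn_lt v hv hs := neg_lt_neg (h.up_lt v hv hs)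
  ne v hv hs ht e := h.ne (dn v) (h.dn_mem v hv hs) ht (by rwa [e]) (by rw [e])

theorem Rankable.symm {G : SimpleGraph V} {S : Finset V} {s t : V} (h : Rankable G S s t) :
    Rankable G S t s :=
  let ⟨_, _, _, h⟩ := h
  ⟨_, _, _, h.symm⟩

theorem Rankable.mono {G H : SimpleGraph V} (hGH : G ≤ H) {S : Finset V} {s t : V}
    (h : Rankable G S s t) : Rankable H S s t := by
  obtain ⟨f, up, dn, h⟩ := h
  exact ⟨f, up, dn, h.up_mem, fun v hv ht => hGH (h.up_adj v hv ht), h.up_lt, h.dn_mem,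
    fun v hv hs => hGH (h.dn_adj v hv hs), h.dn_lt, h.ne⟩

theorem exists_injective_refinement [Finite V] (f : V → ℝ) :
    ∃ g : V → ℝ, Function.Injective g ∧ ∀ v w, f v < f w → g v < g w := by
  classical
  have := Fintype.ofFinite V
  let e := Fintype.equivFin V
  let k : V → ℝ ×ₗ Fin (Fintype.card V) := fun v => toLex (f v, e v)
  have hk : Function.Injective k := fun v w h => e.injective (congrArg (fun p => (ofLex p).2) h)
  let _ : LinearOrder V := LinearOrder.lift' k hk
  let o := Fintype.orderIsoFinOfCardEq V rfl
  refine ⟨fun v => ((o.symm v : ℕ) : ℝ), fun v w h => ?_, fun v w h => ?_⟩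
  · exact o.symm.injective (Fin.ext (Nat.cast_injective h))
  · have hlt : v < w := show k v < k w from Prod.Lex.toLex_lt_toLex.2 (Or.inl h)
    have : o.symm v < o.symm w := o.symm.strictMono hlt
    exact Nat.cast_lt.2 this

theorem Rankable.exists_injective [Finite V] {G : SimpleGraph V} {S : Finset V} {s t : V}
    (h : Rankable G S s t) :
    ∃ (f : V → ℝ) (up dn : V → V), Function.Injective f ∧ IsRanking G S s t f up dn := by
  obtain ⟨f, up, dn, h⟩ := h
  obtain ⟨g, hg, hfg⟩ := exists_injective_refinement f
  exact ⟨g, up, dn, hg, h.up_mem, h.up_adj, fun v hv ht => hfg _ _ (h.up_lt v hv ht),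
    h.dn_mem, h.dn_adj, fun v hv hs => hfg _ _ (h.dn_lt v hv hs), h.ne⟩

theorem IsRanking.insert_between [DecidableEq V] {G : SimpleGraph V} {S : Finset V} {s t : V}
    {f : V → ℝ} {up dn : V → V} (h : IsRanking G S s t f up dn) {v a b : V} (hv : v ∉ S)
    (ha : a ∈ S) (hb : b ∈ S) (hva : G.Adj v a) (hvb : G.Adj v b)
    (hab : f a < f b) : Rankable G (insert v S) s t := by
  obtain ⟨r, har, hrb⟩ := exists_between hab
  obtain ⟨h1, h2, h3, h4, h5, h6, h7⟩ := h
  refine ⟨Function.update f v r, Function.update up v b, Function.update dn v a, ?_, ?_, ?_, ?_,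
    ?_, ?_, ?_⟩ <;> grind [Function.update_apply]

theorem Rankable.insert_inner [Finite V] [DecidableEq V] {G : SimpleGraph V} {S : Finset V}
    {s t : V} (h : Rankable G S s t) {v a b : V} (hv : v ∉ S)
    (ha : a ∈ S) (hb : b ∈ S) (hva : G.Adj v a) (hvb : G.Adj v b) (hab : a ≠ b) :
    Rankable G (insert v S) s t := by
  obtain ⟨f, up, dn, hf, h⟩ := h.exists_injective
  rcases lt_or_gt_of_ne (hf.ne hab) with hlt | hlt
  · exact h.insert_between hv ha hb hva hvb hlt
  · exact h.insert_between hv hb ha hvb hva hlt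

theorem Rankable.insert_bottom [DecidableEq V] {G : SimpleGraph V} {S : Finset V}
    {s t : V} (h : Rankable G S s t) {v a : V} (hv : v ∉ S)
    (ha : a ∈ S) (hvs : G.Adj v s) (hva : G.Adj v a) (has : a ≠ s) :
    Rankable G (insert v S) v t := by
  obtain ⟨f, up, dn, h1, h2, h3, h4, h5, h6, h7⟩ := h
  obtain ⟨r, hr⟩ : ∃ r : ℝ, ∀ w ∈ S, r < f w := by
    obtain ⟨b, hb⟩ := (S.image f).bddBelow
    exact ⟨b - 1, fun w hw => by
      have := hb (Finset.mem_coe.2 (Finset.mem_image_of_mem f hw)); linarith⟩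
  have := hvs.symm
  refine ⟨Function.update f v r, Function.update up v a, Function.update dn s v, ?_, ?_, ?_, ?_,
    ?_, ?_, ?_⟩ <;> grind [Function.update_apply]

/-- Replacing the used edge `ab` by a vertex `v` adjacent to `a`, `b` and `c`. -/
theorem IsRanking.subdivide_up [DecidableEq V] {G : SimpleGraph V} {S : Finset V} {s t a b c v : V}
    {f : V → ℝ} {up dn : V → V} (h : IsRanking (G ⊔ edge a b) S s t f up dn)
    (hf : Function.Injective f) (hv : v ∉ S) (ha : a ∈ S) (hb : b ∈ S)
    (hc : c ∈ S) (hac : a ≠ c) (hbc : b ≠ c) (hva : G.Adj v a) (hvb : G.Adj v b)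
    (hvc : G.Adj v c) (hat : a ≠ t) (hup : up a = b) : Rankable G (insert v S) s t := by
  obtain ⟨h1, h2, h3, h4, h5, h6, h7⟩ := h
  have hlt : f a < f b := hup ▸ h3 a ha hat
  have hba : b ≠ s → dn b ≠ a := hup ▸ h7 a ha hat
  have hav := hva.symm
  have h2' : ∀ x ∈ S, x ≠ t → x ≠ a → G.Adj x (up x) := by
    intro x hx hxt hxa
    have h := h2 x hx hxt
    simp only [sup_adj, edge_adj] at h
    rcases h with h | ⟨⟨rfl, -⟩ | ⟨rfl, h⟩, -⟩
    · exact h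
    · exact absurd rfl hxa
    · have := h3 x hx hxt
      rw [h] at this
      exact absurd this hlt.not_gt
  have h5' : ∀ x ∈ S, x ≠ s → G.Adj x (dn x) := by
    intro x hx hxs
    have h := h5 x hx hxs
    simp only [sup_adj, edge_adj] at h
    rcases h with h | ⟨⟨rfl, h⟩ | ⟨rfl, h⟩, -⟩
    · exact h
    · have := h6 x hx hxs
      rw [h] at this
      exact absurd this hlt.not_gt
    · exact absurd h (hba hxs)
  clear h2 h5
  rcases lt_or_gt_of_ne (hf.ne hbc) with hlt' | hlt'
  · obtain ⟨r, hr⟩ := exists_between hlt'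
    clear hf
    refine ⟨Function.update f v r, Function.update (Function.update up a v) v c,
      Function.update dn v b, ?_, ?_, ?_, ?_, ?_, ?_, ?_⟩ <;>
      intro x hx <;> obtain rfl | hx := Finset.mem_insert.1 hx <;>
      simp only [Function.update_apply, Finset.mem_insert] <;> grind
  · obtain ⟨r, hr⟩ := exists_between (max_lt hlt hlt')
    rw [max_lt_iff] at hr
    clear hf
    refine ⟨Function.update f v r, Function.update (Function.update up a v) v b,
      Function.update dn v c, ?_, ?_, ?_, ?_, ?_, ?_, ?_⟩ <;>
      intro x hx <;> obtain rfl | hx := Finset.mem_insert.1 hx <;>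
      simp only [Function.update_apply, Finset.mem_insert] <;> grind

theorem Rankable.subdivide [Finite V] [DecidableEq V] {G : SimpleGraph V} {S : Finset V}
    {s t a b c v : V} (h : Rankable (G ⊔ edge a b) S s t) (hv : v ∉ S)
    (ha : a ∈ S) (hb : b ∈ S) (hc : c ∈ S) (hab : a ≠ b) (hac : a ≠ c) (hbc : b ≠ c)
    (hva : G.Adj v a) (hvb : G.Adj v b) (hvc : G.Adj v c) : Rankable G (insert v S) s t := by
  obtain ⟨f, up, dn, hf, h⟩ := h.exists_injective
  have hf' : Function.Injective fun v => -f v := neg_injective.comp hf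
  by_cases hA : a ≠ t ∧ up a = b
  · exact h.subdivide_up hf hv ha hb hc hac hbc hva hvb hvc hA.1 hA.2
  by_cases hB : b ≠ t ∧ up b = a
  · exact (edge_comm a b ▸ h).subdivide_up hf hv hb ha hc hbc hac hvb hva hvc
      hB.1 hB.2
  by_cases hC : a ≠ s ∧ dn a = b
  · exact (h.symm.subdivide_up hf' hv ha hb hc hac hbc hva hvb hvc hC.1 hC.2).symm
  by_cases hD : b ≠ s ∧ dn b = a
  · exact ((edge_comm a b ▸ h).symm.subdivide_up hf' hv hb ha hc hbc hac hvb hva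
      hvc hD.1 hD.2).symm
  obtain ⟨h1, h2, h3, h4, h5, h6, h7⟩ := h
  simp only [sup_adj, edge_adj] at h2 h5
  have hG : Rankable G S s t :=
    ⟨f, up, dn, h1, by grind, h3, h4, by grind, h6, h7⟩
  exact hG.insert_inner hv ha hb hva hvb hab

/-- A set of at least four vertices in which every ordered pair of distinct vertices is
rankable. -/
def Good (G : SimpleGraph V) (S : Finset V) : Prop :=
  4 ≤ S.card ∧ ∀ s ∈ S, ∀ t ∈ S, s ≠ t → Rankable G S s t

theorem Good.mono {G H : SimpleGraph V} (hGH : G ≤ H) {S : Finset V} (h : Good G S) : Good H S :=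
  ⟨h.1, fun s hs t ht hst => (h.2 s hs t ht hst).mono hGH⟩

theorem Good.insert_vertex [Finite V] [DecidableEq V] {G : SimpleGraph V} {S : Finset V}
    (h : Good G S) {v a b : V} (hv : v ∉ S) (ha : a ∈ S) (hb : b ∈ S) (hab : a ≠ b) (hva : G.Adj v a)
    (hvb : G.Adj v b) : Good G (insert v S) := by
  have key : ∀ t ∈ S, Rankable G (insert v S) v t := by
    intro t ht
    by_cases hat : a = t
    · exact (h.2 b hb t ht (hat ▸ hab.symm)).insert_bottom hv ha hvb hva hab
    · exact (h.2 a ha t ht hat).insert_bottom hv hb hva hvb hab.symm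
  refine ⟨h.1.trans (Finset.card_le_card (Finset.subset_insert _ _)), fun s hs t ht hst => ?_⟩
  rcases Finset.mem_insert.1 hs with rfl | hs'
  · exact key t (Finset.mem_of_mem_insert_of_ne ht hst.symm)
  rcases Finset.mem_insert.1 ht with rfl | ht'
  · exact (key s hs').symm
  · exact (h.2 s hs' t ht' hst).insert_inner hv ha hb hva hvb hab

theorem rankable_of_clique [DecidableEq V] {G : SimpleGraph V} {s x y t : V}
    (hsx : G.Adj s x) (hsy : G.Adj s y) (hst : G.Adj s t) (hxy : G.Adj x y) (hxt : G.Adj x t)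
    (hyt : G.Adj y t) : Rankable G {s, x, y, t} s t := by
  have h1 := hsx.ne
  have h2 := hsy.ne
  have h3 := hst.ne
  have h4 := hxy.ne
  have h5 := hxt.ne
  have h6 := hyt.ne
  refine ⟨fun v => if v = s then 0 else if v = x then 1 else if v = y then 2 else 3,
    fun v => if v = s then y else t, fun v => if v = y then x else if v = x then s else
      if v = t then s else y, ?_, ?_, ?_, ?_, ?_, ?_, ?_⟩ <;>
    simp only [Finset.mem_insert, Finset.mem_singleton, forall_eq_or_imp, forall_eq] <;>
    norm_num [*, h1.symm, h2.symm, h3.symm, h4.symm, h5.symm, h6.symm, hsx.symm, hst.symm, hxy.symm]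

theorem good_of_clique [DecidableEq V] {G : SimpleGraph V} {a b c d : V}
    (hab : G.Adj a b) (hac : G.Adj a c) (had : G.Adj a d) (hbc : G.Adj b c) (hbd : G.Adj b d)
    (hcd : G.Adj c d) : Good G {a, b, c, d} := by
  constructor
  · rw [Finset.card_eq_succ.2 ⟨a, {b, c, d}, ?_, rfl, ?_⟩]
    · simp [hab.ne, hac.ne, had.ne]
    · rw [Finset.card_eq_three]
      exact ⟨b, c, d, hbc.ne, hbd.ne, hcd.ne, rfl⟩
  · have hba := hab.symm
    have hca := hac.symm
    have hda := had.symm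
    have hcb := hbc.symm
    have hdb := hbd.symm
    have hdc := hcd.symm
    have e : ∀ {s x y t : V}, ({s, x, y, t} : Finset V) = {a, b, c, d} →
      G.Adj s x → G.Adj s y → G.Adj s t → G.Adj x y → G.Adj x t → G.Adj y t →
      Rankable G {a, b, c, d} s t := by
      intro s x y t e h1 h2 h3 h4 h5 h6
      exact e ▸ rankable_of_clique h1 h2 h3 h4 h5 h6
    simp only [Finset.mem_insert, Finset.mem_singleton, forall_eq_or_imp, forall_eq, ne_eq,
      not_true_eq_false, false_imp_iff, true_and, and_true]
    refine ⟨⟨fun _ => ?_, fun _ => ?_, fun _ => ?_⟩, ⟨fun _ => ?_, fun _ => ?_, fun _ => ?_⟩,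
      ⟨fun _ => ?_, fun _ => ?_, fun _ => ?_⟩, ⟨fun _ => ?_, fun _ => ?_, fun _ => ?_⟩⟩
    · exact e (x := c) (y := d) (by grind) ‹_› ‹_› ‹_› ‹_› ‹_› ‹_›
    · exact e (x := b) (y := d) (by grind) ‹_› ‹_› ‹_› ‹_› ‹_› ‹_›
    · exact e (x := b) (y := c) (by grind) ‹_› ‹_› ‹_› ‹_› ‹_› ‹_›
    · exact e (x := c) (y := d) (by grind) ‹_› ‹_› ‹_› ‹_› ‹_› ‹_›
    · exact e (x := a) (y := d) (by grind) ‹_› ‹_› ‹_› ‹_› ‹_› ‹_›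
    · exact e (x := a) (y := c) (by grind) ‹_› ‹_› ‹_› ‹_› ‹_› ‹_›
    · exact e (x := b) (y := d) (by grind) ‹_› ‹_› ‹_› ‹_› ‹_› ‹_›
    · exact e (x := a) (y := d) (by grind) ‹_› ‹_› ‹_› ‹_› ‹_› ‹_›
    · exact e (x := a) (y := b) (by grind) ‹_› ‹_› ‹_› ‹_› ‹_› ‹_›
    · exact e (x := b) (y := c) (by grind) ‹_› ‹_› ‹_› ‹_› ‹_› ‹_›
    · exact e (x := a) (y := c) (by grind) ‹_› ‹_› ‹_› ‹_› ‹_› ‹_›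
    · exact e (x := a) (y := b) (by grind) ‹_› ‹_› ‹_› ‹_› ‹_› ‹_›

/-- Attaching a triangle `cde` whose last vertex is neither source nor sink. -/
theorem Good.rankable_triangle [Finite V] [DecidableEq V] {G : SimpleGraph V} {C : Finset V}
    (h : Good G C) {c d e x y z s t : V} (hc : c ∉ C) (hd : d ∉ C) (he : e ∉ C) (hx : x ∈ C)
    (hy : y ∈ C) (hz : z ∈ C) (hcd : G.Adj c d) (hce : G.Adj c e) (hde : G.Adj d e)
    (hcx : G.Adj c x) (hdy : G.Adj d y) (hez : G.Adj e z) (hxyz : ¬(x = y ∧ y = z))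
    (hs : s ∈ C ∪ {c, d, e}) (ht : t ∈ C ∪ {c, d, e}) (hes : e ≠ s) (het : e ≠ t) (hst : s ≠ t) :
    Rankable G (C ∪ {c, d, e}) s t := by
  have h1 := hcd.ne
  have h2 := hce.ne
  have h3 := hde.ne
  have hcz : c ≠ z := by rintro rfl; exact hc hz
  have hdz : d ≠ z := by rintro rfl; exact hd hz
  by_cases hxz : x = z
  · have hyz : y ≠ z := fun h => hxyz ⟨by rw [hxz, h], h⟩
    have H : Good (G ⊔ edge d z) (insert c (insert d C)) :=
      ((h.mono le_sup_left).insert_vertex hd hy hz hyz (Or.inl hdy) (by simp [edge_adj, hdz]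
        )).insert_vertex (a := d) (b := x) (by simp [h1, hc]) (by simp) (by simp [hx])
        (by rintro rfl; exact hd hx) (Or.inl hcd) (Or.inl hcx)
    have := (H.2 s (by grind) t (by grind) hst).subdivide (v := e) (c := c) (by grind)
      (by grind) (by grind) (by grind) hdz h1.symm hcz.symm hde.symm hez hce.symm
    convert this using 1
    grind
  · have H : Good (G ⊔ edge c z) (insert d (insert c C)) :=
      ((h.mono le_sup_left).insert_vertex hc hx hz hxz (Or.inl hcx) (by simp [edge_adj, hcz]
        )).insert_vertex (a := c) (b := y) (by simp [h1.symm, hd]) (by simp) (by simp [hy])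
        (by rintro rfl; exact hc hy) (Or.inl hcd.symm) (Or.inl hdy)
    have := (H.2 s (by grind) t (by grind) hst).subdivide (v := e) (c := d) (by grind)
      (by grind) (by grind) (by grind) hcz h1 hdz.symm hce.symm hez hde.symm
    convert this using 1
    grind

theorem Good.union_triangle [Finite V] [DecidableEq V] {G : SimpleGraph V} {C : Finset V}
    (h : Good G C) {c d e x y z : V} (hc : c ∉ C) (hd : d ∉ C) (he : e ∉ C) (hx : x ∈ C)
    (hy : y ∈ C) (hz : z ∈ C) (hcd : G.Adj c d) (hce : G.Adj c e) (hde : G.Adj d e)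
    (hcx : G.Adj c x) (hdy : G.Adj d y) (hez : G.Adj e z) (hxyz : ¬(x = y ∧ y = z)) :
    Good G (C ∪ {c, d, e}) := by
  refine ⟨h.1.trans (Finset.card_le_card Finset.subset_union_left), fun s hs t ht hst => ?_⟩
  have h1 := hcd.ne
  have h2 := hce.ne
  have h3 := hde.ne
  by_cases h4 : e ≠ s ∧ e ≠ t
  · exact h.rankable_triangle hc hd he hx hy hz hcd hce hde hcx hdy hez hxyz hs ht h4.1 h4.2 hst
  by_cases h5 : d ≠ s ∧ d ≠ t
  · have e1 : ({c, d, e} : Finset V) = {c, e, d} := by grind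
    rw [e1] at hs ht ⊢
    exact h.rankable_triangle hc he hd hx hz hy hce hcd hde.symm hcx hez hdy (by grind) hs ht
      h5.1 h5.2 hst
  · have e1 : ({c, d, e} : Finset V) = {d, e, c} := by grind
    rw [e1] at hs ht ⊢
    exact h.rankable_triangle hd he hc hy hz hx hde hcd.symm hce.symm hdy hez hcx (by grind) hs ht
      (by grind) (by grind) hst

open Classical in
/-- The number of neighbors of `v` in `X`. -/
noncomputable def degIn (G : SimpleGraph V) (X : Finset V) (v : V) : ℕ :=
  (X.filter (G.Adj v)).card

/-- The degree sum of the subgraph induced by `X`. -/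
noncomputable def degSum (G : SimpleGraph V) (X : Finset V) : ℕ := ∑ v ∈ X, degIn G X v

theorem degIn_mono {G H : SimpleGraph V} (hGH : G ≤ H) (X : Finset V) (v : V) :
    degIn G X v ≤ degIn H X v := by
  classical
  exact Finset.card_le_card (Finset.monotone_filter_right X fun _ _ h => hGH h)

theorem degIn_union [DecidableEq V] (G : SimpleGraph V) {X Y : Finset V} (h : Disjoint X Y)
    (v : V) : degIn G (X ∪ Y) v = degIn G X v + degIn G Y v := by
  classical
  rw [degIn, Finset.filter_union, Finset.card_union_of_disjoint
    (Finset.disjoint_filter_filter h)]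
  rfl

open Classical in
theorem degIn_erase_add [DecidableEq V] {G : SimpleGraph V} {X : Finset V} {u : V} (hu : u ∈ X)
    (v : V) : degIn G (X.erase u) v + (if G.Adj v u then 1 else 0) = degIn G X v := by
  simp only [degIn, Finset.card_filter]
  rw [Finset.sum_erase_add _ _ hu]

theorem degIn_le {G : SimpleGraph V} {X : Finset V} {v : V} (hv : v ∈ X) :
    degIn G X v + 1 ≤ X.card := by
  classical
  refine Finset.card_lt_card (Finset.filter_ssubset.2 ⟨v, hv, G.loopless.irrefl v⟩)

theorem adj_of_degIn {G : SimpleGraph V} {X : Finset V} {v w : V} (hv : v ∈ X) (hw : w ∈ X)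
    (hvw : v ≠ w) (h : X.card ≤ degIn G X v + 1) : G.Adj v w := by
  classical
  by_contra hadj
  have h1 := degIn_erase_add (G := G) hw v
  have h2 := degIn_le (G := G) (Finset.mem_erase.2 ⟨hvw, hv⟩)
  rw [if_neg hadj] at h1
  rw [Finset.card_erase_of_mem hw] at h2
  omega

theorem exists_adj_of_degIn_pos {G : SimpleGraph V} {X : Finset V} {v : V}
    (h : 0 < degIn G X v) : ∃ w ∈ X, G.Adj v w := by
  classical
  obtain ⟨w, hw⟩ := Finset.card_pos.1 h
  exact ⟨w, Finset.mem_filter.1 hw⟩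

theorem exists_two_adj_of_degIn {G : SimpleGraph V} {X : Finset V} {v : V}
    (h : 2 ≤ degIn G X v) : ∃ a ∈ X, ∃ b ∈ X, a ≠ b ∧ G.Adj v a ∧ G.Adj v b := by
  classical
  obtain ⟨a, ha, b, hb, hab⟩ := Finset.one_lt_card.1 h
  rw [Finset.mem_filter] at ha hb
  exact ⟨a, ha.1, b, hb.1, hab, ha.2, hb.2⟩

open Classical in
theorem degSum_erase_add [DecidableEq V] {G : SimpleGraph V} {X : Finset V} {v : V} (hv : v ∈ X) :
    degSum G (X.erase v) + 2 * degIn G X v = degSum G X := by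
  have h1 : ∑ w ∈ X.erase v, (if G.Adj w v then 1 else 0) = degIn G X v := by
    rw [degIn, Finset.card_filter, ← Finset.sum_erase_add _ _ hv]
    simp [G.adj_comm]
  rw [degSum, degSum, ← Finset.sum_erase_add X _ hv, two_mul, ← add_assoc]
  congr 1
  rw [← h1, ← Finset.sum_add_distrib]
  exact Finset.sum_congr rfl fun w _ => degIn_erase_add hv w

theorem degSum_le (G : SimpleGraph V) (X : Finset V) : degSum G X ≤ X.card * (X.card - 1) :=
  (Finset.sum_le_card_nsmul X _ (X.card - 1) fun v hv => by
    have := degIn_le (G := G) hv; omega).trans_eq (by simp)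

theorem even_degSum (G : SimpleGraph V) (X : Finset V) : Even (degSum G X) := by
  classical
  induction X using Finset.induction_on with
  | empty => simp [degSum]
  | insert v X hv ih =>
    rw [← degSum_erase_add (Finset.mem_insert_self v X), Finset.erase_insert hv]
    exact ih.add (even_two_mul _)

theorem degSum_sup_edge {G : SimpleGraph V} {X : Finset V} {a b : V} (ha : a ∈ X) (hb : b ∈ X)
    (hab : a ≠ b) (hadj : ¬G.Adj a b) : degSum (G ⊔ edge a b) X = degSum G X + 2 := by
  classical
  have hadj' : ¬G.Adj b a := fun h => hadj h.symm
  have h1 := degSum_erase_add (G := G) ha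
  have h2 := degSum_erase_add (G := G ⊔ edge a b) ha
  have h3 := degIn_erase_add (G := G) hb a
  have h4 := degIn_erase_add (G := G ⊔ edge a b) hb a
  rw [if_neg hadj] at h3
  rw [if_pos (by simp [edge_adj, hab])] at h4
  have h5 : degIn (G ⊔ edge a b) (X.erase b) a = degIn G (X.erase b) a := by
    unfold degIn
    congr 1
    ext w
    simp only [Finset.mem_filter, Finset.mem_erase, sup_adj, edge_adj]
    grind
  have h6 : degSum (G ⊔ edge a b) (X.erase a) = degSum G (X.erase a) := by
    refine Finset.sum_congr rfl fun v hv => ?_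
    unfold degIn
    congr 1
    ext w
    have := Finset.ne_of_mem_erase hv
    simp only [Finset.mem_filter, Finset.mem_erase, sup_adj, edge_adj]
    grind
  omega

theorem exists_le_degSum (G : SimpleGraph V) (X : Finset V) {N : ℕ} (hN : N ≤ degSum G X) :
    ∃ H ≤ G, N ≤ degSum H X ∧ degSum H X ≤ N + 1 := by
  induction hd : degSum G X using Nat.strong_induction_on generalizing G with
  | _ d ih =>
  subst hd
  by_cases hle : degSum G X ≤ N + 1
  · exact ⟨G, le_rfl, hN, hle⟩
  obtain ⟨a, ha, hpos⟩ : ∃ a ∈ X, 0 < degIn G X a := by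
    by_contra! h
    have : degSum G X = 0 := Finset.sum_eq_zero fun v hv => Nat.le_zero.1 (h v hv)
    omega
  obtain ⟨b, hb, hab⟩ := exists_adj_of_degIn_pos hpos
  have hsup : G.deleteEdges {s(a, b)} ⊔ edge a b = G := by
    ext u v
    have := hab.ne
    have := hab.symm
    simp only [sup_adj, deleteEdges_adj, edge_adj, Set.mem_singleton_iff, Sym2.eq_iff]
    constructor
    · rintro (h | ⟨⟨rfl, rfl⟩ | ⟨rfl, rfl⟩, -⟩)
      exacts [h.1, hab, hab.symm]
    · intro h
      have := h.ne
      tauto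
  have h1 := degSum_sup_edge (G := G.deleteEdges {s(a, b)}) ha hb hab.ne (by simp)
  rw [hsup] at h1
  obtain ⟨H, hH, h⟩ := ih _ (by omega) (G.deleteEdges {s(a, b)}) (by omega) rfl
  exact ⟨H, hH.trans (deleteEdges_le _), h⟩

theorem Good.of_sup_edge {G : SimpleGraph V} {C : Finset V} {a b : V}
    (h : Good (G ⊔ edge a b) C) (hab : ¬(a ∈ C ∧ b ∈ C)) : Good G C := by
  refine ⟨h.1, fun s hs t ht hst => ?_⟩
  obtain ⟨f, up, dn, h⟩ := h.2 s hs t ht hst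
  have key : ∀ v ∈ C, ∀ w ∈ C, (G ⊔ edge a b).Adj v w → G.Adj v w := by
    intro v hv w hw hvw
    simp only [sup_adj, edge_adj] at hvw
    grind
  exact ⟨f, up, dn, h.up_mem, fun v hv ht => key _ hv _ (h.up_mem v hv ht) (h.up_adj v hv ht),
    h.up_lt, h.dn_mem, fun v hv hs => key _ hv _ (h.dn_mem v hv hs) (h.dn_adj v hv hs), h.dn_lt,
    h.ne⟩

theorem exists_max_good [Finite V] {G : SimpleGraph V} {X Y : Finset V} (hYX : Y ⊆ X)
    (hY : Good G Y) : ∃ C ⊆ X, Good G C ∧ (∀ D ⊆ X, Good G D → D.card ≤ C.card) ∧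
      ∀ w ∈ X, w ∉ C → degIn G C w ≤ 1 := by
  classical
  obtain ⟨C, hC, hmax⟩ := (X.powerset.filter (Good G)).exists_max_image Finset.card
    ⟨Y, by simp [hYX, hY]⟩
  simp only [Finset.mem_filter, Finset.mem_powerset] at hC hmax
  refine ⟨C, hC.1, hC.2, fun D hD hG => hmax D ⟨hD, hG⟩, fun w hw hwC => ?_⟩
  by_contra! h
  obtain ⟨a, ha, b, hb, hab, hwa, hwb⟩ := exists_two_adj_of_degIn h
  have := hmax _ ⟨Finset.insert_subset hw hC.1, hC.2.insert_vertex hwC ha hb hab hwa hwb⟩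
  rw [Finset.card_insert_of_notMem hwC] at this
  omega

/-- In a set without good subsets, splitting off a vertex `v` of degree three by adding an edge
between two of its neighbors leaves a good set. -/
theorem good_split [Finite V] [DecidableEq V] {G : SimpleGraph V} {X : Finset V}
    (hX : X.card ≤ 8)
    (ih : ∀ (H : SimpleGraph V) (Y : Finset V), 2 ≤ Y.card → Y.card < X.card →
      4 * Y.card ≤ degSum H Y + 4 → ∃ Z ⊆ Y, Good H Z)
    (hno : ∀ Y ⊆ X, ¬Good G Y) (hdeg : ∀ v ∈ X, 3 ≤ degIn G X v)
    (hsum : 4 * X.card ≤ degSum G X + 4) {v a b c : V} (hv : v ∈ X) (hvdeg : degIn G X v = 3)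
    (ha : a ∈ X) (hb : b ∈ X) (hva : G.Adj v a) (hvb : G.Adj v b)
    (hc : ∀ w ∈ X, G.Adj v w → w = a ∨ w = b ∨ w = c)
    (hab : a ≠ b) (hadj : ¬G.Adj a b) : Good (G ⊔ edge a b) (X.erase v) := by
  classical
  have hcard := Finset.card_erase_of_mem hv
  have hXv := degIn_le (G := G) hv
  have ha' : a ∈ X.erase v := Finset.mem_erase.2 ⟨hva.ne', ha⟩
  have hb' : b ∈ X.erase v := Finset.mem_erase.2 ⟨hvb.ne', hb⟩
  have h1 := degSum_sup_edge ha' hb' hab hadj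
  have h2 := degSum_erase_add (G := G) hv
  obtain ⟨Z, hZX, hZ⟩ := ih (G ⊔ edge a b) (X.erase v) (by omega) (by omega) (by omega)
  obtain ⟨C, hCX, hC, hmax, hout⟩ := exists_max_good hZX hZ
  have hCX' : C ⊆ X := hCX.trans (Finset.erase_subset _ _)
  obtain ⟨haC, hbC⟩ : a ∈ C ∧ b ∈ C := by
    by_contra h
    exact hno C hCX' (hC.of_sup_edge h)
  by_cases hCeq : C = X.erase v
  · exact hCeq ▸ hC
  exfalso
  obtain ⟨D, hD⟩ : ∃ D, D = X.erase v \ C := ⟨_, rfl⟩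
  have hDC : Disjoint C D := hD ▸ Finset.disjoint_sdiff
  have hCD : C ∪ D = X.erase v := by rw [hD, Finset.union_sdiff_of_subset hCX]
  have hcardD : C.card + D.card + 1 = X.card := by
    rw [← Finset.card_union_of_disjoint hDC, hCD, hcard]
    have := Finset.card_pos.2 ⟨v, hv⟩
    omega
  have hmemD : ∀ w ∈ D, w ∈ X ∧ w ≠ v ∧ w ∉ C := by
    intro w hw
    rw [hD] at hw
    simp only [Finset.mem_sdiff, Finset.mem_erase] at hw
    tauto
  have hC4 := hC.1
  have hsplit : ∀ w, degIn G C w + degIn G D w + (if G.Adj w v then 1 else 0) = degIn G X w := by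
    intro w
    rw [← degIn_union G hDC, hCD, degIn_erase_add hv]
  have hCle : ∀ w ∈ D, degIn G C w ≤ 1 := fun w hw =>
    (degIn_mono le_sup_left C w).trans (hout w (hCD ▸ Finset.mem_union_right _ hw) (hmemD w hw).2.2)
  have hnadj : ∀ w ∈ D, w ≠ c → ¬G.Adj w v := by
    intro w hw hwc hwv
    rcases hc w (hmemD w hw).1 hwv.symm with rfl | rfl | rfl
    · exact (hmemD _ hw).2.2 haC
    · exact (hmemD _ hw).2.2 hbC
    · exact hwc rfl
  obtain ⟨w₀, hw₀⟩ : D.Nonempty := by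
    rw [Finset.nonempty_iff_ne_empty]
    rintro rfl
    simp at hCD
    exact hCeq hCD
  obtain ⟨w, hw, hwc⟩ : ∃ w ∈ D, w ≠ c := by
    by_contra! h
    have hD1 : D.card ≤ 1 := Finset.card_le_one.2 fun x hx y hy => by rw [h x hx, h y hy]
    have h3 := degIn_le (G := G) hw₀
    have h4 := hsplit w₀
    have h5 := hdeg w₀ (hmemD w₀ hw₀).1
    have h6 := hCle w₀ hw₀
    split_ifs at h4 <;> omega
  have hD2 : ∀ w ∈ D, w ≠ c → 2 ≤ degIn G D w ∧ (D.card = 3 → 1 ≤ degIn G C w) := by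
    intro w hw hwc
    have h3 := degIn_le (G := G) hw
    have h4 := hsplit w
    have h5 := hdeg w (hmemD w hw).1
    have h6 := hCle w hw
    rw [if_neg (hnadj w hw hwc)] at h4
    constructor <;> omega
  have hD3 : D.card = 3 := by
    have h3 := degIn_le (G := G) hw
    have := hD2 w hw hwc
    omega
  have hDadj : ∀ x ∈ D, ∀ y ∈ D, x ≠ y → G.Adj x y := by
    intro x hx y hy hxy
    by_cases hxc : x = c
    · exact (adj_of_degIn hy hx hxy.symm
        (by have := (hD2 y hy (hxc ▸ hxy.symm)).1; omega)).symm
    · exact adj_of_degIn hx hy hxy (by have := (hD2 x hx hxc).1; omega)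
  have hDdeg : ∀ x ∈ D, degIn G D x = 2 := by
    intro x hx
    have : D.filter (G.Adj x) = D.erase x := by
      ext y
      simp only [Finset.mem_filter, Finset.mem_erase]
      exact ⟨fun h => ⟨h.2.ne', h.1⟩, fun h => ⟨h.2, hDadj x hx y h.2 h.1.symm⟩⟩
    rw [degIn, this, Finset.card_erase_of_mem hx, hD3]
  have hCpos : ∀ x ∈ D, 0 < degIn G C x := by
    intro x hx
    by_cases hxc : x = c
    swap
    · exact (hD2 x hx hxc).2 hD3
    by_contra hzero
    obtain ⟨d, e, hde, hDx⟩ := Finset.card_eq_two.1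
      (show (D.erase x).card = 2 by rw [Finset.card_erase_of_mem hx, hD3])
    have hd : d ∈ D.erase x := hDx ▸ by simp
    have he : e ∈ D.erase x := hDx ▸ by simp
    rw [Finset.mem_erase] at hd he
    have key : ∀ y ∈ D, y ≠ c → degIn G X y = 3 := by
      intro y hy hyc
      have h3 := hsplit y
      have h4 := (hD2 y hy hyc).2 hD3
      have h5 := hCle y hy
      have h6 := hDdeg y hy
      rw [if_neg (hnadj y hy hyc)] at h3
      omega
    have hx3 : degIn G X x ≤ 3 := by
      have h3 := hsplit x
      have h6 := hDdeg x hx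
      split_ifs at h3 <;> omega
    have hd3 := key d hd.2 (hxc ▸ hd.1)
    have he3 := key e he.2 (hxc ▸ he.1)
    have hxX := (hmemD x hx).1
    have hdX : d ∈ X.erase x := Finset.mem_erase.2 ⟨hd.1, (hmemD d hd.2).1⟩
    have heX : e ∈ X.erase x := Finset.mem_erase.2 ⟨he.1, (hmemD e he.2).1⟩
    have heX' : e ∈ (X.erase x).erase d := Finset.mem_erase.2 ⟨hde.symm, heX⟩
    have e1 := degIn_erase_add (G := G) hxX d
    have e2 := degIn_erase_add (G := G) hxX e
    have e3 := degIn_erase_add (G := G) hdX e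
    rw [if_pos (hDadj d hd.2 x hx hd.1)] at e1
    rw [if_pos (hDadj e he.2 x hx he.1)] at e2
    rw [if_pos (hDadj e he.2 d hd.2 hde.symm)] at e3
    have f1 := degSum_erase_add (G := G) hxX
    have f2 := degSum_erase_add (G := G) hdX
    have f3 := degSum_erase_add (G := G) heX'
    have c1 := Finset.card_erase_of_mem hxX
    have c2 := Finset.card_erase_of_mem hdX
    have c3 := Finset.card_erase_of_mem heX'
    obtain ⟨Y, hY, hYG⟩ := ih G (((X.erase x).erase d).erase e) (by omega) (by omega) (by omega)
    exact hno Y (hY.trans ((Finset.erase_subset _ _).trans ((Finset.erase_subset _ _).trans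
      (Finset.erase_subset _ _)))) hYG
  obtain ⟨d, e, f, hde, hdf, hef, rfl⟩ := Finset.card_eq_three.1 hD3
  have hd : d ∈ ({d, e, f} : Finset V) := by simp
  have he : e ∈ ({d, e, f} : Finset V) := by simp
  have hf : f ∈ ({d, e, f} : Finset V) := by simp
  obtain ⟨x, hx, hdx⟩ := exists_adj_of_degIn_pos (hCpos d hd)
  obtain ⟨y, hy, hey⟩ := exists_adj_of_degIn_pos (hCpos e he)
  obtain ⟨z, hz, hfz⟩ := exists_adj_of_degIn_pos (hCpos f hf)
  by_cases hxyz : x = y ∧ y = z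
  · obtain ⟨rfl, rfl⟩ := hxyz
    refine hno {d, e, f, x} ?_ (good_of_clique (hDadj d hd e he hde) (hDadj d hd f hf hdf) hdx
      (hDadj e he f hf hef) hey hfz)
    have := hCX' hx
    have := (hmemD d hd).1
    have := (hmemD e he).1
    have := (hmemD f hf).1
    intro u hu
    simp only [Finset.mem_insert, Finset.mem_singleton] at hu
    grind
  · have hle : G ≤ G ⊔ edge a b := le_sup_left
    have hgood := hC.union_triangle (hmemD d hd).2.2 (hmemD e he).2.2 (hmemD f hf).2.2 hx hy hz
      (hle (hDadj d hd e he hde)) (hle (hDadj d hd f hf hdf)) (hle (hDadj e he f hf hef))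
      (hle hdx) (hle hey) (hle hfz) hxyz
    have := hmax _ hCD.le hgood
    rw [Finset.card_union_of_disjoint hDC] at this
    omega

theorem exists_good_of_degSum [Finite V] (G : SimpleGraph V) (X : Finset V) (h2 : 2 ≤ X.card)
    (h8 : X.card ≤ 8) (hsum : 4 * X.card ≤ degSum G X + 4) : ∃ Y ⊆ X, Good G Y := by
  classical
  induction hm : X.card using Nat.strong_induction_on generalizing G X with
  | _ m ih =>
  subst hm
  obtain ⟨H, hHG, hlow, hupp⟩ := exists_le_degSum G X (N := 4 * X.card - 4) (by omega)
  suffices ∃ Y ⊆ X, Good H Y by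
    obtain ⟨Y, hY, h⟩ := this
    exact ⟨Y, hY, h.mono hHG⟩
  clear hsum
  by_contra! hno
  have hdeg : ∀ v ∈ X, 3 ≤ degIn H X v := by
    intro v hv
    by_contra! hlt
    have h3 := degSum_erase_add (G := H) hv
    have h4 := Finset.card_erase_of_mem hv
    have h5 := degSum_le H X
    by_cases hX : X.card = 2
    · rw [hX] at h5
      omega
    obtain ⟨Y, hY, hg⟩ := ih _ (by omega) H (X.erase v) (by omega) (by omega) (by omega) rfl
    exact hno Y (hY.trans (Finset.erase_subset _ _)) hg
  refine hno X subset_rfl ⟨?_, fun s hs t ht hst => ?_⟩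
  · obtain ⟨v, hv⟩ := Finset.card_pos.1 (by omega : 0 < X.card)
    have := degIn_le (G := H) hv
    have := hdeg v hv
    omega
  obtain ⟨v, hv, hvs, hvt, hv3⟩ : ∃ v ∈ X, v ≠ s ∧ v ≠ t ∧ degIn H X v = 3 := by
    by_contra! hne
    have ht' : t ∈ X.erase s := Finset.mem_erase.2 ⟨hst.symm, ht⟩
    have h3 : degSum H X = ∑ v ∈ (X.erase s).erase t, degIn H X v + degIn H X t + degIn H X s := by
      rw [degSum, Finset.sum_erase_add _ _ ht', Finset.sum_erase_add _ _ hs]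
    have h4 : ((X.erase s).erase t).card • 4 ≤ ∑ v ∈ (X.erase s).erase t, degIn H X v := by
      refine Finset.card_nsmul_le_sum _ _ _ fun v hv => ?_
      simp only [Finset.mem_erase] at hv
      have := hdeg v hv.2.2
      have := hne v hv.2.2 hv.2.1 hv.1
      omega
    rw [Finset.card_erase_of_mem ht', Finset.card_erase_of_mem hs, smul_eq_mul] at h4
    have := hdeg s hs
    have := hdeg t ht
    omega
  have hIH : ∀ (H : SimpleGraph V) (Y : Finset V), 2 ≤ Y.card → Y.card < X.card →
      4 * Y.card ≤ degSum H Y + 4 → ∃ Z ⊆ Y, Good H Z :=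
    fun H Y hY hlt hs => ih _ hlt H Y hY (by omega) hs rfl
  have key : ∀ a b c : V, X.filter (H.Adj v) = {a, b, c} → a ≠ b → a ≠ c → b ≠ c →
      ¬H.Adj a b → Rankable H X s t := by
    intro a b c habc hab hac hbc hadj
    have hmem : ∀ w, (w ∈ X ∧ H.Adj v w) ↔ w = a ∨ w = b ∨ w = c := by
      intro w
      rw [← Finset.mem_filter, habc]
      simp
    have ha := (hmem a).2 (by simp)
    have hb := (hmem b).2 (by simp)
    have hc := (hmem c).2 (by simp)
    have hgood := good_split h8 hIH hno hdeg (by omega) hv hv3 ha.1 hb.1 ha.2 hb.2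
      (c := c) (fun w hw hvw => (hmem w).1 ⟨hw, hvw⟩) hab hadj
    have hr := (hgood.2 s (by simp [hs, hvs.symm]) t (by simp [ht, hvt.symm]) hst).subdivide
      (v := v) (c := c) (by simp) (Finset.mem_erase.2 ⟨ha.2.ne', ha.1⟩)
      (Finset.mem_erase.2 ⟨hb.2.ne', hb.1⟩) (Finset.mem_erase.2 ⟨hc.2.ne', hc.1⟩) hab hac hbc
      ha.2 hb.2 hc.2
    rwa [Finset.insert_erase hv] at hr
  obtain ⟨a, b, c, hab, hac, hbc, habc⟩ := Finset.card_eq_three.1 hv3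
  by_cases h1 : H.Adj a b
  · by_cases h2 : H.Adj a c
    · by_cases h3 : H.Adj b c
      · have hmem : ∀ w, (w ∈ X ∧ H.Adj v w) ↔ w = a ∨ w = b ∨ w = c := by
          intro w
          rw [← Finset.mem_filter, habc]
          simp
        have ha := (hmem a).2 (by simp)
        have hb := (hmem b).2 (by simp)
        have hc := (hmem c).2 (by simp)
        refine absurd (good_of_clique ha.2 hb.2 hc.2 h1 h2 h3) (hno _ ?_)
        intro w hw
        simp only [Finset.mem_insert, Finset.mem_singleton] at hw
        grind
      · exact key b c a (habc.trans (by grind)) hbc hab.symm hac.symm h3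
    · exact key a c b (habc.trans (by grind)) hac hab hbc.symm h2
  · exact key a b c habc hab hac hbc h1

/-- Deleting vertices of at most average degree reduces to a set of at most eight vertices. -/
theorem exists_good_of_dense [Finite V] (G : SimpleGraph V) (X : Finset V) (h8 : 8 ≤ X.card)
    (hsum : X.card * (X.card - 1) ≤ 2 * degSum G X) : ∃ Y ⊆ X, Good G Y := by
  classical
  obtain ⟨m, hm⟩ : ∃ m, X.card = m := ⟨_, rfl⟩
  rw [hm] at h8
  induction m, h8 using Nat.le_induction generalizing X with
  | base =>
    rw [hm] at hsum
    exact exists_good_of_degSum G X (by omega) (by omega) (by omega)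
  | succ m hm8 ih =>
    rw [hm] at hsum
    obtain ⟨v, hv, hmin⟩ := X.exists_min_image (degIn G X) (Finset.card_pos.1 (by omega))
    have h1 := degSum_erase_add (G := G) hv
    have h2 := Finset.card_erase_of_mem hv
    have h3 : (X.erase v).card = m := by omega
    have h4 : X.card • degIn G X v ≤ degSum G X := Finset.card_nsmul_le_sum _ _ _ hmin
    rw [smul_eq_mul, hm] at h4
    obtain ⟨Y, hY, hg⟩ := ih (X.erase v) (by
      rw [h3]
      obtain ⟨k, rfl⟩ : ∃ k, m = k + 1 := ⟨m - 1, by omega⟩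
      simp only [Nat.add_sub_cancel] at hsum ⊢
      nlinarith) h3
    exact ⟨Y, hY.trans (Finset.erase_subset _ _), hg⟩

theorem sum_degIn_comm (G : SimpleGraph V) (S T : Finset V) :
    ∑ v ∈ S, degIn G T v = ∑ v ∈ T, degIn G S v := by
  classical
  simp only [degIn, Finset.card_filter]
  rw [Finset.sum_comm]
  simp only [G.adj_comm]

theorem degIn_add_card_le (G : SimpleGraph V) {X Y : Finset V} (h : Y ⊆ X) (v : V) :
    degIn G X v + Y.card ≤ degIn G Y v + X.card := by
  classical
  have h1 := degIn_union G (Finset.disjoint_sdiff (s := Y) (t := X)) v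
  have h2 : degIn G (X \ Y) v ≤ (X \ Y).card := Finset.card_filter_le _ _
  rw [Finset.union_sdiff_of_subset h] at h1
  have h3 := Finset.card_sdiff_add_card_eq_card h
  omega

/-- A set of at least five vertices in which each vertex misses at most one other is good. -/
theorem good_of_degIn [Finite V] {G : SimpleGraph V} {T : Finset V} (h5 : 5 ≤ T.card)
    (hT : ∀ v ∈ T, T.card ≤ degIn G T v + 2) : Good G T := by
  obtain ⟨Y, hYT, hY⟩ := Finset.exists_subset_card_eq h5
  have h1 : Y.card • 3 ≤ degSum G Y := Finset.card_nsmul_le_sum _ _ _ fun v hv => by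
    have := degIn_add_card_le G hYT v
    have := hT v (hYT hv)
    omega
  have h2 : 16 ≤ degSum G Y := by
    have := even_degSum G Y
    rw [hY, smul_eq_mul] at h1
    grind
  obtain ⟨Z, hZY, hZ⟩ := exists_good_of_degSum G Y (by omega) (by omega) (by omega)
  obtain ⟨C, hCT, hC, -, hout⟩ := exists_max_good (hZY.trans hYT) hZ
  have : C = T := hCT.antisymm fun w hw => by
    by_contra hwC
    have h3 := degIn_add_card_le G hCT w
    have h4 := hT w hw
    have h5 := hout w hw hwC
    have h6 := hC.1
    omega
  exact this ▸ hC

theorem good_univ_or_isTwoCliquesAtVertex [Fintype V] (G : SimpleGraph V)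
    (hn : 8 ≤ Fintype.card V)
    (hdeg : ∀ v : V, Fintype.card V / 2 ≤ degIn G Finset.univ v) :
    Good G Finset.univ ∨
      (Odd (Fintype.card V) ∧ IsTwoCliquesAtVertex G ((Fintype.card V + 1) / 2)) := by
  classical
  obtain ⟨k, hk⟩ : ∃ k, Fintype.card V / 2 = k := ⟨_, rfl⟩
  rw [hk] at hdeg
  have hsum : Fintype.card V * k ≤ degSum G Finset.univ := by
    rw [← Finset.card_univ, ← smul_eq_mul]
    exact Finset.card_nsmul_le_sum _ _ _ fun v _ => hdeg v
  obtain ⟨Y, hY, hYG⟩ := exists_good_of_dense G Finset.univ (by rwa [Finset.card_univ]) (by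
    rw [Finset.card_univ]
    have : Fintype.card V * (Fintype.card V - 1) ≤ Fintype.card V * (2 * k) :=
      Nat.mul_le_mul_left _ (by omega)
    linarith)
  obtain ⟨S, -, hS, hmax, hout⟩ := exists_max_good hY hYG
  by_cases hSuniv : S = Finset.univ
  · exact Or.inl (hSuniv ▸ hS)
  have hS4 := hS.1
  obtain ⟨T, hT⟩ : ∃ T, T = Sᶜ := ⟨_, rfl⟩
  have hST : Disjoint S T := hT ▸ disjoint_compl_right
  have hSTu : S ∪ T = Finset.univ := by rw [hT, Finset.union_compl]
  have hcard : S.card + T.card = Fintype.card V := by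
    rw [hT, Finset.card_add_card_compl]
  have hmemT : ∀ v, v ∈ T ↔ v ∉ S := fun v => by rw [hT, Finset.mem_compl]
  have hsplit : ∀ v, k ≤ degIn G S v + degIn G T v := by
    intro v
    rw [← degIn_union G hST, hSTu]
    exact hdeg v
  have hle : ∀ v ∈ T, degIn G S v ≤ 1 := fun v hv => hout v (Finset.mem_univ _) ((hmemT v).1 hv)
  obtain ⟨v₀, hv₀⟩ : T.Nonempty := by
    rw [Finset.nonempty_iff_ne_empty]
    rintro rfl
    simp at hSTu
    exact hSuniv hSTu
  have hTk : k ≤ T.card := by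
    have := degIn_le (G := G) hv₀
    have := hle v₀ hv₀
    have := hsplit v₀
    omega
  have hSk : k ≤ S.card := by
    by_contra! hlt
    have h1 : S.card • (k + 1 - S.card) ≤ ∑ v ∈ S, degIn G T v :=
      Finset.card_nsmul_le_sum _ _ _ fun v hv => by
        have := degIn_le (G := G) hv
        have := hsplit v
        omega
    have h2 : ∑ v ∈ T, degIn G S v ≤ T.card • 1 := Finset.sum_le_card_nsmul _ _ _ hle
    rw [sum_degIn_comm] at h1
    obtain ⟨j, rfl⟩ := Nat.exists_eq_add_of_lt hlt
    rw [show S.card + j + 1 + 1 - S.card = j + 2 by omega, smul_eq_mul] at h1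
    rw [smul_eq_mul] at h2
    have h3 : T.card ≤ S.card + 2 * j + 3 := by omega
    nlinarith
  by_cases hTk' : T.card = k
  swap
  · have hTgood : Good G T := good_of_degIn (by omega) fun v hv => by
      have := hle v hv
      have := hsplit v
      omega
    have := hmax T (Finset.subset_univ _) hTgood
    omega
  have hclique : ∀ u ∈ T, ∀ v ∈ T, u ≠ v → G.Adj u v := fun u hu v hv huv =>
    adj_of_degIn hu hv huv (by
      have := hle u hu
      have := hsplit u
      omega)
  have hone : ∀ v ∈ T, ∃ x ∈ S, G.Adj v x ∧ ∀ y ∈ S, G.Adj v y → y = x := by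
    intro v hv
    have h1 := degIn_le (G := G) hv
    have h2 := hsplit v
    have h3 := hle v hv
    obtain ⟨x, hx, hvx⟩ := exists_adj_of_degIn_pos (G := G) (X := S) (v := v) (by omega)
    exact ⟨x, hx, hvx, fun y hy hvy => Finset.card_le_one.1 h3 y (by simp [hy, hvy]) x
      (by simp [hx, hvx])⟩
  choose! φ hφS hφadj hφ using hone
  by_cases hconst : ∀ v ∈ T, φ v = φ v₀
  swap
  · push Not at hconst
    obtain ⟨e, he, hne⟩ := hconst
    have hev : e ≠ v₀ := by rintro rfl; exact hne rfl
    obtain ⟨f, hf, hfn⟩ := Finset.exists_mem_notMem_of_card_lt_card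
      (s := {e, v₀}) (t := T) (by have := Finset.card_le_two (a := e) (b := v₀); omega)
    simp only [Finset.mem_insert, Finset.mem_singleton, not_or] at hfn
    have hgood := hS.union_triangle ((hmemT e).1 he) ((hmemT v₀).1 hv₀) ((hmemT f).1 hf)
      (hφS e he) (hφS v₀ hv₀) (hφS f hf) (hclique e he v₀ hv₀ hev)
      (hclique e he f hf (Ne.symm hfn.1)) (hclique v₀ hv₀ f hf (Ne.symm hfn.2))
      (hφadj e he) (hφadj v₀ hv₀) (hφadj f hf) (fun h => hne h.1)
    have h1 := hmax _ (Finset.subset_univ _) hgood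
    have h2 : S.card < (S ∪ {e, v₀, f}).card := Finset.card_lt_card
      (Finset.ssubset_iff_of_subset Finset.subset_union_left |>.2
        ⟨e, by simp, (hmemT e).1 he⟩)
    omega
  right
  obtain ⟨x, hx⟩ : ∃ x, φ v₀ = x := ⟨_, rfl⟩
  have hxS : x ∈ S := hx ▸ hφS v₀ hv₀
  have hTx : ∀ v ∈ T, G.Adj v x := fun v hv => by
    rw [← hx, ← hconst v hv]
    exact hφadj v hv
  have hTx' : ∀ v ∈ T, ∀ y ∈ S, G.Adj v y → y = x := fun v hv y hy h => by
    rw [← hx, ← hconst v hv]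
    exact hφ v hv y hy h
  have hSdeg : ∀ w ∈ S, w ≠ x → k ≤ degIn G S w := by
    intro w hw hwx
    have h1 := hsplit w
    have h2 : degIn G T w = 0 := by
      by_contra h
      obtain ⟨v, hv, hwv⟩ := exists_adj_of_degIn_pos (Nat.pos_of_ne_zero h)
      exact hwx (hTx' v hv w hw hwv.symm)
    omega
  obtain ⟨w, hw, hwx⟩ := Finset.exists_mem_ne (by omega : 1 < S.card) x
  have hSk1 : S.card = k + 1 := by
    have := hSdeg w hw hwx
    have := degIn_le (G := G) hw
    omega
  have hSclique : ∀ u ∈ S, ∀ v ∈ S, u ≠ v → G.Adj u v := by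
    intro u hu v hv huv
    by_cases hux : u = x
    · exact (adj_of_degIn hv hu huv.symm
        (by have := hSdeg v hv (hux ▸ huv.symm); omega)).symm
    · exact adj_of_degIn hu hv huv (by have := hSdeg u hu hux; omega)
  refine ⟨⟨k, by omega⟩, S, insert x T, x, ?_, ?_, ?_, ?_, fun u v => ?_⟩
  · ext y
    have := hmemT y
    simp only [Set.mem_inter_iff, Set.mem_insert_iff, Finset.mem_coe, Set.mem_singleton_iff]
    grind
  · ext y
    have := hmemT y
    simp only [Set.mem_union, Set.mem_insert_iff, Finset.mem_coe, Set.mem_univ]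
    grind
  · rw [Set.ncard_coe_finset]
    omega
  · rw [← Finset.coe_insert, Set.ncard_coe_finset, Finset.card_insert_of_notMem
      (fun h => (hmemT x).1 h hxS)]
    omega
  · have hu := hmemT u
    have hv := hmemT v
    simp only [Set.mem_insert_iff, Finset.mem_coe]
    constructor
    · intro h
      refine ⟨h.ne, ?_⟩
      by_cases huS : u ∈ S <;> by_cases hvS : v ∈ S
      · exact Or.inl ⟨huS, hvS⟩
      · exact Or.inr ⟨Or.inl (hTx' v (hv.2 hvS) u huS h.symm), Or.inr (hv.2 hvS)⟩
      · exact Or.inr ⟨Or.inr (hu.2 huS), Or.inl (hTx' u (hu.2 huS) v hvS h)⟩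
      · exact Or.inr ⟨Or.inr (hu.2 huS), Or.inr (hv.2 hvS)⟩
    · rintro ⟨hne, ⟨hu, hv⟩ | ⟨rfl | hu, rfl | hv⟩⟩
      · exact hSclique u hu v hv hne
      · exact absurd rfl hne
      · exact (hTx v hv).symm
      · exact hTx u hu
      · exact hclique u hu v hv hne

/-- The graph of all edges joining a vertex other than `t` to its image under `up`. -/
def towardGraph (t : V) (up : V → V) : SimpleGraph V :=
  fromRel fun v w => v ≠ t ∧ up v = w

/-- If `up` increases `f` away from `t`, it defines a tree. -/
theorem isTree_towardGraph [Fintype V] {t : V} {up : V → V} {f : V → ℝ}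
    (h : ∀ v, v ≠ t → f v < f (up v)) : (towardGraph t up).IsTree := by
  classical
  have hadj : ∀ v, v ≠ t → (towardGraph t up).Adj v (up v) := fun v hv => by
    refine (fromRel_adj _ _ _).2 ⟨fun e => ?_, Or.inl ⟨hv, rfl⟩⟩
    have := h v hv
    rw [← e] at this
    exact lt_irrefl _ this
  have hreach : ∀ v, (towardGraph t up).Reachable v t := by
    have hwf : WellFounded fun v w : V => f w < f v :=
      Finite.wellFounded_of_trans_of_irrefl _
    intro v
    induction v using hwf.induction with
    | _ v ih =>
    by_cases hv : v = t
    · rw [hv]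
    · exact (hadj v hv).reachable.trans (ih _ (h v hv))
  have hconn : (towardGraph t up).Connected :=
    { preconnected := fun v w => (hreach v).trans (hreach w).symm
      nonempty := ⟨t⟩ }
  refine isTree_iff_connected_and_card.2 ⟨hconn, le_antisymm ?_
    hconn.card_vert_le_card_edgeSet_add_one⟩
  have hsub : (towardGraph t up).edgeSet ⊆ (fun v => s(v, up v)) '' {v | v ≠ t} := by
    intro e
    induction e using Sym2.ind with
    | _ v w =>
    rw [mem_edgeSet, towardGraph, fromRel_adj]
    rintro ⟨-, ⟨hv, rfl⟩ | ⟨hw, rfl⟩⟩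
    · exact ⟨v, hv, rfl⟩
    · exact ⟨w, hw, Sym2.eq_swap⟩
  have h1 : Nat.card (towardGraph t up).edgeSet ≤ {v | v ≠ t}.ncard :=
    (Set.ncard_le_ncard hsub).trans (Set.ncard_image_le)
  have h2 : {v | v ≠ t}.ncard + 1 = Nat.card V := by
    rw [← Set.ncard_add_ncard_compl {v | v ≠ t}]
    simp [Set.compl_ofPred]
  omega

theorem Rankable.exists_isTwoT [Fintype V] {G : SimpleGraph V} {s t : V} (hst : s ≠ t)
    (h : Rankable G Finset.univ s t) :
    ∃ H : SimpleGraph V, H ≤ G ∧ IsTwoT H ∧ HasSTTriple H s t := by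
  obtain ⟨f, up, dn, hf, h⟩ := h.exists_injective
  have hup : ∀ v, v ≠ t → f v < f (up v) := fun v => h.up_lt v (Finset.mem_univ v)
  have hdn : ∀ v, v ≠ s → f (dn v) < f v := fun v => h.dn_lt v (Finset.mem_univ v)
  have hne : ∀ v, v ≠ t → up v ≠ s → dn (up v) ≠ v := fun v => h.ne v (Finset.mem_univ v)
  have hI := isTree_towardGraph hup
  have hO := isTree_towardGraph (t := s) (up := dn) (f := fun v => -f v)
    fun v hv => neg_lt_neg (hdn v hv)
  have hle : towardGraph t up ⊔ towardGraph s dn ≤ G := by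
    refine sup_le (fun v w hvw => ?_) fun v w hvw => ?_ <;>
      rw [towardGraph, fromRel_adj] at hvw <;> obtain ⟨-, ⟨hv, rfl⟩ | ⟨hw, rfl⟩⟩ := hvw
    · exact h.up_adj v (Finset.mem_univ v) hv
    · exact (h.up_adj w (Finset.mem_univ w) hw).symm
    · exact h.dn_adj v (Finset.mem_univ v) hv
    · exact (h.dn_adj w (Finset.mem_univ w) hw).symm
  have hdisj : towardGraph t up ⊓ towardGraph s dn = ⊥ := by
    refine eq_bot_iff.2 fun v w => ?_
    rw [inf_adj, towardGraph, towardGraph, fromRel_adj, fromRel_adj]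
    rintro ⟨⟨-, ⟨hv, rfl⟩ | ⟨hw, rfl⟩⟩, -, ⟨hv', e⟩ | ⟨hw', e⟩⟩
    · exact absurd (hup v hv) (e ▸ hdn v hv').not_gt
    · exact hne v hv hw' e
    · exact hne w hw hv' e
    · exact absurd (hup w hw) (e ▸ hdn w hw').not_gt
  have hI' : IsSpanningTree (towardGraph t up ⊔ towardGraph s dn) (towardGraph t up) :=
    ⟨le_sup_left, hI.1, hI.2⟩
  have hO' : IsSpanningTree (towardGraph t up ⊔ towardGraph s dn) (towardGraph s dn) :=
    ⟨le_sup_right, hO.1, hO.2⟩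
  refine ⟨_, hle, ⟨?_, _, _, hI', hO', hdisj, rfl⟩, LinearOrder.lift' f hf, _, _, hI', hO', hdisj,
    fun v hv => ⟨up v, ?_, hup v hv⟩, fun v hv => ⟨dn v, ?_, hdn v hv⟩⟩
  · rw [Nat.card_eq_fintype_card]
    exact Fintype.one_lt_card_iff.2 ⟨s, t, hst⟩
  · refine (fromRel_adj _ _ _).2 ⟨fun e => ?_, Or.inl ⟨hv, rfl⟩⟩
    exact (hup v hv).ne (congrArg f e)
  · refine (fromRel_adj _ _ _).2 ⟨fun e => ?_, Or.inl ⟨hv, rfl⟩⟩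
    exact (hdn v hv).ne' (congrArg f e)

theorem gdeg_eq_degIn [Fintype V] (G : SimpleGraph V) (v : V) :
    gdeg G v = degIn G Finset.univ v := by
  classical
  rw [gdeg, degIn, ← Set.ncard_coe_finset]
  congr 1
  ext w
  simp

/-- Every simple graph on `n ≥ 8` vertices with minimum degree at least `⌊n/2⌋` has
property (*), unless `n` is odd and `G` is obtained by identifying two disjoint copies
of `K_{⌈n/2⌉}` at a single vertex. -/
theorem stmt3 [Fintype V] (G : SimpleGraph V)
    (hn : 8 ≤ Fintype.card V)
    (hdeg : ∀ v : V, Fintype.card V / 2 ≤ gdeg G v) :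
    PropertyStar G ∨
      (Odd (Fintype.card V) ∧ IsTwoCliquesAtVertex G ((Fintype.card V + 1) / 2)) := by
  rcases good_univ_or_isTwoCliquesAtVertex G hn fun v => gdeg_eq_degIn G v ▸ hdeg v with h | h
  · exact Or.inl fun s t hst =>
      (h.2 s (Finset.mem_univ s) t (Finset.mem_univ t) hst).exists_isTwoT hst
  · exact Or.inr h
end
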